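/- arXiv:math/0612749 — 6 statements merged into one kernel-verified Lean document; each statement's English description precedes it below -/
import Mathlib

section
/- For every integer m ≥ 1, setting N = 12m, there exist N distinct pairwise parallel lines l₁, …, l_N in ℝ² and 2N+1 distinct lines λ₁, …, λ_{2N+1}, none of which is parallel to the lines l_i, such that for every i the set of intersection points ⋃_{j} (l_i ∩ λ_j) contains at most N−1 points. -/
/-- A line in the plane: a one-dimensional affine subspace of ℝ². -/
def IsLine (l : AffineSubspace ℝ (ℝ × ℝ)) : Prop :=
  Module.finrank ℝ l.direction = 1

open Real in
/-- cosines of multiples of π / N -/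
noncomputable def bcos (N : ℕ) (n : ℤ) : ℝ := Real.cos (n * (π / N))

open Real in
noncomputable def brad (N : ℕ) : ℝ := 2 * Real.sin (π / N)

open Real in
lemma bcos_reduce (N : ℕ) (hN : 0 < N) (n : ℤ) :
    ∃ k : ℕ, k ≤ N ∧ (k : ℤ) % 2 = n % 2 ∧ bcos N n = bcos N k := by
  have hN0 : (N : ℝ) ≠ 0 := by positivity
  have h2 : (0 : ℤ) < 2 * N := by positivity
  have hd := Int.emod_add_mul_ediv n (2 * N)
  have h0 := Int.emod_nonneg n h2.ne'
  have h1 := Int.emod_lt_of_pos n h2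
  obtain ⟨q, hq⟩ : ∃ q, q = n / (2 * N) := ⟨_, rfl⟩
  obtain ⟨e, he⟩ : ∃ e, e = n % (2 * N) := ⟨_, rfl⟩
  rw [← he] at hd h0 h1
  rw [← hq] at hd
  have hpar : n % 2 = e % 2 := by
    rw [← hd, mul_assoc]; omega
  have hc : bcos N n = bcos N e := by
    unfold bcos
    rw [← hd]
    push_cast
    rw [show ((e : ℝ) + 2 * N * q) * (π / N) = e * (π / N) + q * (2 * π) by field_simp]
    exact Real.cos_add_int_mul_two_pi _ _
  rcases le_or_gt e N with h | h
  · refine ⟨e.toNat, by omega, by omega, ?_⟩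
    rw [hc, Int.toNat_of_nonneg h0]
  · refine ⟨(2 * N - e).toNat, by omega, by omega, ?_⟩
    rw [hc, Int.toNat_of_nonneg (by omega)]
    unfold bcos
    push_cast
    rw [show (2 * (N : ℝ) - e) * (π / N) = 2 * π - e * (π / N) by field_simp]
    rw [Real.cos_two_pi_sub]

open Real in
lemma bcos_half (N : ℕ) (M : ℕ) (hM : 0 < M) (hN : N = 2 * M) (j : ℤ) :
    bcos N (M - j) = Real.sin (j * (π / N)) := by
  have : (M : ℝ) ≠ 0 := by positivity
  unfold bcos
  rw [← Real.cos_pi_div_two_sub]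
  congr 1
  subst hN
  push_cast
  field_simp

open Real in
lemma key_even (m : ℕ) (hm : 1 ≤ m) (N : ℕ) (hN : N = 12 * m) :
    ∃ F : Finset ℝ, F.card ≤ N - 1 ∧ (0 : ℝ) ∈ F ∧ (∀ n : ℤ, n % 2 = 0 → bcos N n ∈ F) ∧
      (∀ n : ℤ, n % 2 = 1 → brad N * bcos N n ∈ F) := by
  have hE : ∀ n : ℤ, n % 2 = 0 →
      bcos N n ∈ (Finset.range (6 * m + 1)).image (fun i : ℕ => bcos N (2 * i)) := by
    intro n hn
    obtain ⟨k, hk, hp, hc⟩ := bcos_reduce N (by omega) n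
    rw [Finset.mem_image]
    refine ⟨k / 2, Finset.mem_range.2 (by omega), ?_⟩
    rw [hc]
    congr 1
    omega
  refine ⟨(Finset.range (6 * m + 1)).image (fun i : ℕ => bcos N (2 * i)) ∪
    (Finset.Ico 1 (6 * m - 1)).image (fun i : ℕ => brad N * bcos N (2 * i + 1)), ?_, ?_, ?_, ?_⟩
  · refine (Finset.card_union_le _ _).trans ?_
    have h1 := Finset.card_image_le (s := Finset.range (6 * m + 1))
      (f := fun i : ℕ => bcos N (2 * i))
    have h2 := Finset.card_image_le (s := Finset.Ico 1 (6 * m - 1))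
      (f := fun i : ℕ => brad N * bcos N (2 * i + 1))
    simp only [Finset.card_range, Nat.card_Ico] at h1 h2
    omega
  · apply Finset.mem_union_left
    have := hE ((6 * m : ℕ) - 0) (by omega)
    rw [bcos_half N (6 * m) (by omega) (by omega)] at this
    simpa using this
  · intro n hn
    exact Finset.mem_union_left _ (hE n hn)
  · intro n hn
    obtain ⟨k, hk, hp, hc⟩ := bcos_reduce N (by omega) n
    have hN0 : (N : ℝ) ≠ 0 := by
      have : N ≠ 0 := by omega
      exact_mod_cast this
    rw [hc]
    by_cases h1 : k = 1
    · apply Finset.mem_union_left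
      have := hE ((6 * m : ℕ) - 2) (by omega)
      rw [bcos_half N (6 * m) (by omega) (by omega)] at this
      convert this using 1
      subst h1
      unfold brad bcos
      push_cast
      rw [Real.sin_two_mul, one_mul]
    by_cases h2 : k = N - 1
    · apply Finset.mem_union_left
      have := hE ((6 * m : ℕ) - (-2)) (by omega)
      rw [bcos_half N (6 * m) (by omega) (by omega)] at this
      convert this using 1
      have hk1 : (k : ℝ) = N - 1 := by
        rw [h2, Nat.cast_sub (by omega)]; simp
      unfold brad bcos
      push_cast
      rw [hk1, show ((N : ℝ) - 1) * (π / N) = π - π / N by field_simp, Real.cos_pi_sub,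
        neg_mul, Real.sin_neg, Real.sin_two_mul]
      ring
    · apply Finset.mem_union_right
      rw [Finset.mem_image]
      refine ⟨k / 2, Finset.mem_Ico.2 (by omega), ?_⟩
      congr 2
      omega

open Real in
lemma key_odd (m : ℕ) (hm : 1 ≤ m) (N : ℕ) (hN : N = 12 * m) :
    ∃ F : Finset ℝ, F.card ≤ N - 1 ∧ (0 : ℝ) ∈ F ∧ (∀ n : ℤ, n % 2 = 1 → bcos N n ∈ F) ∧
      (∀ n : ℤ, n % 2 = 0 → brad N * bcos N n ∈ F) := by
  have hE : ∀ n : ℤ, n % 2 = 1 →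
      bcos N n ∈ (Finset.range (6 * m)).image (fun i : ℕ => bcos N (2 * i + 1)) := by
    intro n hn
    obtain ⟨k, hk, hp, hc⟩ := bcos_reduce N (by omega) n
    rw [Finset.mem_image]
    refine ⟨k / 2, Finset.mem_range.2 (by omega), ?_⟩
    rw [hc]
    congr 1
    omega
  have hO : ∀ n : ℕ, n % 2 = 0 → n ≤ N → n ≠ 4 * m → n ≠ 8 * m → brad N * bcos N n ∈
      (((Finset.range (6 * m + 1)).erase (2 * m)).erase (4 * m)).image
        (fun i : ℕ => brad N * bcos N (2 * i)) := by
    intro k hp hk h1 h2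
    rw [Finset.mem_image]
    refine ⟨k / 2, ?_, ?_⟩
    · simp only [Finset.mem_erase, Finset.mem_range]
      omega
    · congr 2
      omega
  refine ⟨(Finset.range (6 * m)).image (fun i : ℕ => bcos N (2 * i + 1)) ∪
    (((Finset.range (6 * m + 1)).erase (2 * m)).erase (4 * m)).image
      (fun i : ℕ => brad N * bcos N (2 * i)), ?_, ?_, ?_, ?_⟩
  · refine (Finset.card_union_le _ _).trans ?_
    have h1 := Finset.card_image_le (s := Finset.range (6 * m))
      (f := fun i : ℕ => bcos N (2 * i + 1))
    have h2 := Finset.card_image_le (s := ((Finset.range (6 * m + 1)).erase (2 * m)).erase (4 * m))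
      (f := fun i : ℕ => brad N * bcos N (2 * i))
    rw [Finset.card_erase_of_mem (by simp only [Finset.mem_erase, Finset.mem_range]; omega),
      Finset.card_erase_of_mem (by simp only [Finset.mem_range]; omega)] at h2
    simp only [Finset.card_range] at h1 h2
    omega
  · apply Finset.mem_union_right
    have := hO (6 * m) (by omega) (by omega) (by omega) (by omega)
    have h0 := bcos_half N (6 * m) (by omega) (by omega) 0
    simp only [sub_zero, Int.cast_zero, zero_mul, Real.sin_zero] at h0
    rw [h0, mul_zero] at this
    exact this
  · intro n hn
    exact Finset.mem_union_left _ (hE n hn)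
  · intro n hn
    obtain ⟨k, hk, hp, hc⟩ := bcos_reduce N (by omega) n
    have hm0 : (m : ℝ) ≠ 0 := by
      have : m ≠ 0 := by omega
      exact_mod_cast this
    have hNr : (N : ℝ) = 12 * m := by rw [hN]; push_cast; ring
    rw [hc]
    by_cases h1 : k = 4 * m
    · apply Finset.mem_union_left
      have := hE ((6 * m : ℕ) - 1) (by omega)
      rw [bcos_half N (6 * m) (by omega) (by omega)] at this
      convert this using 1
      unfold brad bcos
      subst h1
      push_cast
      rw [one_mul, show (4 * (m : ℝ)) * (π / N) = π / 3 by rw [hNr]; field_simp; norm_num,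
        Real.cos_pi_div_three]
      ring
    by_cases h2 : k = 8 * m
    · apply Finset.mem_union_left
      have := hE ((6 * m : ℕ) - (-1)) (by omega)
      rw [bcos_half N (6 * m) (by omega) (by omega)] at this
      convert this using 1
      unfold brad bcos
      subst h2
      push_cast
      rw [neg_one_mul, Real.sin_neg,
        show (8 * (m : ℝ)) * (π / N) = π - π / 3 by rw [hNr]; field_simp; norm_num,
        Real.cos_pi_sub, Real.cos_pi_div_three]
      ring
    · exact Finset.mem_union_right _ (hO k (by omega) hk h1 h2)

/-- vertical line -/
noncomputable def vline (t : ℝ) : AffineSubspace ℝ (ℝ × ℝ) :=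
  AffineSubspace.mk' (t, 0) (Submodule.span ℝ {((0 : ℝ), (1 : ℝ))})

/-- the line y = a x + b -/
noncomputable def gline (a b : ℝ) : AffineSubspace ℝ (ℝ × ℝ) :=
  AffineSubspace.mk' (0, b) (Submodule.span ℝ {((1 : ℝ), a)})

lemma mem_vline (t : ℝ) (p : ℝ × ℝ) : p ∈ vline t ↔ p.1 = t := by
  rw [vline, AffineSubspace.mem_mk', Submodule.mem_span_singleton]
  constructor
  · rintro ⟨c, hc⟩
    have := congrArg Prod.fst hc
    simp at this
    linarith
  · intro h
    exact ⟨p.2, by ext <;> simp [h]⟩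

lemma mem_gline (a b : ℝ) (p : ℝ × ℝ) : p ∈ gline a b ↔ p.2 = a * p.1 + b := by
  rw [gline, AffineSubspace.mem_mk', Submodule.mem_span_singleton]
  constructor
  · rintro ⟨c, hc⟩
    have h1 := congrArg Prod.fst hc
    have h2 := congrArg Prod.snd hc
    simp at h1 h2
    subst h1
    linarith
  · intro h
    exact ⟨p.1, by ext <;> simp [h]; ring⟩

lemma gline_inj {a b a' b' : ℝ} (h : gline a b = gline a' b') : a = a' ∧ b = b' := by
  have h1 : ((0 : ℝ), b) ∈ gline a' b' := by rw [← h, mem_gline]; simp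
  have h2 : ((1 : ℝ), a + b) ∈ gline a' b' := by rw [← h, mem_gline]; simp
  rw [mem_gline] at h1 h2
  simp at h1 h2
  exact ⟨by linarith, by linarith⟩

lemma dir_ne (t a b : ℝ) : (gline a b).direction ≠ (vline t).direction := by
  intro h
  rw [gline, vline, AffineSubspace.direction_mk', AffineSubspace.direction_mk'] at h
  have h1 : ((1 : ℝ), a) ∈ Submodule.span ℝ {((0 : ℝ), (1 : ℝ))} := by
    rw [← h]; exact Submodule.mem_span_singleton_self _
  rw [Submodule.mem_span_singleton] at h1
  obtain ⟨c, hc⟩ := h1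
  have := congrArg Prod.fst hc
  simp at this

/-- radius of the j-th point -/
noncomputable def prad (N : ℕ) (j : ℕ) : ℝ :=
  if j < N then 1 else if j < 2 * N then brad N else 0

/-- angle index of the j-th point -/
def pidx (N : ℕ) (j : ℕ) : ℤ := if j < N then 2 * j else 2 * (j - N) + 1

open Real in
noncomputable def pang (N : ℕ) (j : ℕ) : ℝ := pidx N j * (π / N) + π / (2 * N)

open Real in
lemma brad_bounds (m : ℕ) (hm : 1 ≤ m) (N : ℕ) (hN : N = 12 * m) : 0 < brad N ∧ brad N < 1 := by
  have h12 : (12 : ℝ) ≤ N := by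
    have : 12 ≤ N := by omega
    exact_mod_cast this
  have hp := Real.pi_pos
  have hpos : 0 < π / N := by positivity
  have hle : π / N ≤ π / 12 := by gcongr
  have h1 : Real.sin (π / N) < Real.sin (π / 6) :=
    Real.sin_lt_sin_of_lt_of_le_pi_div_two (by linarith) (by linarith) (by linarith)
  rw [Real.sin_pi_div_six] at h1
  have h2 : 0 < Real.sin (π / N) := Real.sin_pos_of_pos_of_lt_pi hpos (by linarith)
  unfold brad
  constructor <;> linarith

open Real in
lemma pang_inj (N : ℕ) (hN : 0 < N) (ρ : ℝ) (hρ : ρ ≠ 0) (j k : ℕ)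
    (h1 : ρ * Real.cos (pang N j) = ρ * Real.cos (pang N k))
    (h2 : ρ * Real.sin (pang N j) = ρ * Real.sin (pang N k)) :
    ∃ q : ℤ, pidx N j - pidx N k = 2 * (N * q) := by
  have h := Real.Angle.cos_sin_inj (mul_left_cancel₀ hρ h1) (mul_left_cancel₀ hρ h2)
  rw [Real.Angle.angle_eq_iff_two_pi_dvd_sub] at h
  obtain ⟨q, hq⟩ := h
  refine ⟨q, ?_⟩
  have hN0 : (N : ℝ) ≠ 0 := by positivity
  have hp := Real.pi_ne_zero
  unfold pang at hq
  have h3 : ((pidx N j : ℝ) - pidx N k) * (π / N) = (2 * (N * q)) * (π / N) := by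
    calc _ = 2 * π * q := by linarith
      _ = _ := by field_simp
  have h4 := mul_right_cancel₀ (div_ne_zero hp hN0) h3
  exact_mod_cast h4

lemma points_inj (m : ℕ) (hm : 1 ≤ m) (N : ℕ) (hN : N = 12 * m) (j k : ℕ)
    (hj : j < 2 * N + 1) (hk : k < 2 * N + 1)
    (h1 : prad N j * Real.cos (pang N j) = prad N k * Real.cos (pang N k))
    (h2 : prad N j * Real.sin (pang N j) = prad N k * Real.sin (pang N k)) : j = k := by
  obtain ⟨hb0, hb1⟩ := brad_bounds m hm N hN
  have hnn : ∀ i, 0 ≤ prad N i := by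
    intro i; unfold prad; split_ifs <;> linarith
  have hr : prad N j = prad N k := by
    have hs : prad N j ^ 2 = prad N k ^ 2 := by
      have e1 := Real.sin_sq_add_cos_sq (pang N j)
      have e2 := Real.sin_sq_add_cos_sq (pang N k)
      calc prad N j ^ 2 = (prad N j * Real.sin (pang N j)) ^ 2
            + (prad N j * Real.cos (pang N j)) ^ 2 := by linear_combination (-prad N j ^ 2) * e1
        _ = _ := by rw [h1, h2]; linear_combination (prad N k ^ 2) * e2
    exact (sq_eq_sq₀ (hnn _) (hnn _)).1 hs
  rw [hr] at h1 h2
  have hcases : (j < N ∧ k < N) ∨ ((N ≤ j ∧ j < 2 * N) ∧ (N ≤ k ∧ k < 2 * N)) ∨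
      (j = 2 * N ∧ k = 2 * N) := by
    unfold prad at hr
    split_ifs at hr <;> first | omega | (exfalso; linarith)
  rcases hcases with ⟨a, b⟩ | ⟨⟨a, b⟩, c, d⟩ | ⟨a, b⟩
  · obtain ⟨q, hq⟩ := pang_inj N (by omega) _ (by simp [prad, b]) j k h1 h2
    unfold pidx at hq
    rw [if_pos a, if_pos b] at hq
    have hq' : (j : ℤ) - k = N * q := by linarith
    have := Int.eq_zero_of_abs_lt_dvd (m := N) (x := (j : ℤ) - k) ⟨q, hq'⟩
      (by rw [abs_lt]; omega)
    omega
  · obtain ⟨q, hq⟩ := pang_inj N (by omega) _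
      (by unfold prad; rw [if_neg (by omega), if_pos d]; exact hb0.ne') j k h1 h2
    unfold pidx at hq
    rw [if_neg (by omega), if_neg (by omega)] at hq
    have hq' : (j : ℤ) - k = N * q := by linarith
    have := Int.eq_zero_of_abs_lt_dvd (m := N) (x := (j : ℤ) - k) ⟨q, hq'⟩
      (by rw [abs_lt]; omega)
    omega
  · omega

open Real in
noncomputable def thet (N : ℕ) (i : ℕ) : ℝ := i * (π / N) + π / (2 * N)

open Real in
lemma thet_bounds (N i : ℕ) (hi : i < N) : 0 < thet N i ∧ thet N i < π := by
  have hN : (0 : ℝ) < N := by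
    have : 0 < N := by omega
    exact_mod_cast this
  have hi' : (i : ℝ) + 1 ≤ N := by exact_mod_cast hi
  have hp := Real.pi_pos
  unfold thet
  constructor
  · positivity
  · rw [show (i : ℝ) * (π / N) + π / (2 * N) = π * ((2 * i + 1) / (2 * N)) by field_simp]
    have : (2 * (i : ℝ) + 1) / (2 * N) < 1 := by
      rw [div_lt_one (by positivity)]; linarith
    nlinarith

lemma thet_inj (N i j : ℕ) (hi : i < N) (hj : j < N)
    (h : Real.cos (thet N i) / Real.sin (thet N i) = Real.cos (thet N j) / Real.sin (thet N j)) :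
    i = j := by
  obtain ⟨a, b⟩ := thet_bounds N i hi
  obtain ⟨c, d⟩ := thet_bounds N j hj
  have s1 := Real.sin_pos_of_pos_of_lt_pi a b
  have s2 := Real.sin_pos_of_pos_of_lt_pi c d
  rw [div_eq_div_iff s1.ne' s2.ne'] at h
  have h0 : Real.sin (thet N j - thet N i) = 0 := by
    rw [Real.sin_sub]; linarith
  rw [Real.sin_eq_zero_iff_of_lt_of_lt (by linarith) (by linarith)] at h0
  have hN : (N : ℝ) ≠ 0 := by
    have : N ≠ 0 := by omega
    exact_mod_cast this
  have h1 : (j : ℝ) * (Real.pi / N) = i * (Real.pi / N) := by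
    unfold thet at h0; linarith
  have := mul_right_cancel₀ (div_ne_zero Real.pi_ne_zero hN) h1
  exact_mod_cast this.symm

lemma values (m : ℕ) (hm : 1 ≤ m) (N : ℕ) (hN : N = 12 * m) (i : ℕ) :
    ∃ F : Finset ℝ, F.card ≤ N - 1 ∧
      ∀ j, prad N j * Real.cos (pang N j - thet N i) ∈ F := by
  have hang : ∀ j, Real.cos (pang N j - thet N i) = bcos N (pidx N j - i) := by
    intro j
    unfold pang thet bcos
    congr 1
    push_cast
    ring
  rcases Nat.even_or_odd' i with ⟨c, hc | hc⟩
  · obtain ⟨F, h1, h2, h3, h4⟩ := key_even m hm N hN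
    refine ⟨F, h1, fun j => ?_⟩
    rw [hang]
    unfold prad pidx
    split_ifs
    · rw [one_mul]; exact h3 _ (by omega)
    · exact h4 _ (by omega)
    · rwa [zero_mul]
  · obtain ⟨F, h1, h2, h3, h4⟩ := key_odd m hm N hN
    refine ⟨F, h1, fun j => ?_⟩
    rw [hang]
    unfold prad pidx
    split_ifs
    · rw [one_mul]; exact h3 _ (by omega)
    · exact h4 _ (by omega)
    · rwa [zero_mul]

/-- For every integer m ≥ 1, setting N = 12m, there are N distinct parallel lines and 2N+1 Brass transversals: lines not parallel to the former, whose union meets each of the N parallel lines in at most N−1 points. -/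
theorem brass_transversals_twelve_m (m : ℕ) (hm : 1 ≤ m) (N : ℕ) (hN : N = 12 * m) :
    ∃ l : Fin N → AffineSubspace ℝ (ℝ × ℝ),
      ∃ lam : Fin (2 * N + 1) → AffineSubspace ℝ (ℝ × ℝ),
        (∀ i, IsLine (l i)) ∧ Function.Injective l ∧
        (∀ i j, (l i).direction = (l j).direction) ∧
        (∀ j, IsLine (lam j)) ∧ Function.Injective lam ∧
        (∀ j i, (lam j).direction ≠ (l i).direction) ∧
        (∀ i, (⋃ j, ((l i : Set (ℝ × ℝ)) ∩ (lam j : Set (ℝ × ℝ)))).ncard ≤ N - 1) := by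
  refine ⟨fun i => vline (Real.cos (thet N i) / Real.sin (thet N i)),
    fun j => gline (prad N j * Real.cos (pang N j)) (prad N j * Real.sin (pang N j)),
    ?_, ?_, ?_, ?_, ?_, ?_, ?_⟩
  · intro i
    unfold IsLine vline
    rw [AffineSubspace.direction_mk']
    exact finrank_span_singleton (by simp)
  · intro i j h
    have h1 : (Real.cos (thet N i) / Real.sin (thet N i), (0 : ℝ)) ∈
        vline (Real.cos (thet N j) / Real.sin (thet N j)) := by
      rw [← show vline _ = vline _ from h, mem_vline]
    rw [mem_vline] at h1
    exact Fin.ext (thet_inj N i j i.2 j.2 h1)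
  · intro i j
    simp only [vline, AffineSubspace.direction_mk']
  · intro j
    unfold IsLine gline
    rw [AffineSubspace.direction_mk']
    exact finrank_span_singleton (by simp)
  · intro j k h
    obtain ⟨h1, h2⟩ := gline_inj h
    exact Fin.ext (points_inj m hm N hN j k j.2 k.2 h1 h2)
  · intro j i
    exact dir_ne _ _ _
  · intro i
    obtain ⟨F, hF, hv⟩ := values m hm N hN i
    obtain ⟨a, b⟩ := thet_bounds N i i.2
    have s1 := Real.sin_pos_of_pos_of_lt_pi a b
    refine le_trans ?_ hF
    refine le_trans (Set.ncard_le_ncard (t := ((F.image (fun y =>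
      (Real.cos (thet N i) / Real.sin (thet N i), y / Real.sin (thet N i))) : Finset (ℝ × ℝ)) :
        Set (ℝ × ℝ))) ?_ (Finset.finite_toSet _)) ?_
    · intro p hp
      rw [Set.mem_iUnion] at hp
      obtain ⟨j, hp1, hp2⟩ := hp
      have e1 := (mem_vline _ _).1 hp1
      have e2 := (mem_gline _ _ _).1 hp2
      rw [Finset.mem_coe, Finset.mem_image]
      refine ⟨_, hv j, ?_⟩
      refine Prod.ext e1.symm ?_
      rw [e2, e1, Real.cos_sub]
      field_simp
    · rw [Set.ncard_coe_finset]
      exact Finset.card_image_le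
end

section
/- For every integer m ≥ 1, setting N = 12m − 1, there exist N distinct pairwise parallel lines l₁, …, l_N in ℝ² and 2N+3 distinct lines λ₁, …, λ_{2N+3}, none of which is parallel to the lines l_i, such that for every i the set of intersection points ⋃_{j} (l_i ∩ λ_j) contains at most N points. (This follows by deleting one parallel line from the configuration of 12m parallel lines with 2·(12m)+1 transversals meeting each parallel line in at most 12m − 1 points.) -/
open Real in
lemma brass_reduce (m : ℕ) (hm : 1 ≤ m) (θ : ℝ) (hθ : 12 * (m : ℝ) * θ = π) (z : ℤ) :
    ∃ k : ℕ, k ≤ 12 * m ∧ ((k : ℤ) % 2 = z % 2) ∧ cos ((z : ℝ) * θ) = cos ((k : ℝ) * θ) := by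
  have hpos : (0 : ℤ) < 24 * m := by omega
  have h0 := Int.emod_nonneg z hpos.ne'
  have h1 := Int.emod_lt_of_pos z hpos
  have h2 := Int.emod_add_mul_ediv z (24 * m)
  set w := z % (24 * m) with hw
  set q := z / (24 * m) with hq
  have hpar : w % 2 = z % 2 := by
    rw [← h2]
    have : (24 * (m : ℤ)) * q = 2 * (12 * m * q) := by ring
    omega
  have hcos : cos ((z : ℝ) * θ) = cos ((w : ℝ) * θ) := by
    have : (z : ℝ) * θ = (w : ℝ) * θ + q * (2 * π) := by
      rw [← hθ, ← h2]; push_cast; ring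
    rw [this, Real.cos_add_int_mul_two_pi]
  by_cases hc : w ≤ 12 * m
  · refine ⟨w.toNat, by omega, by omega, ?_⟩
    have : ((w.toNat : ℕ) : ℝ) = (w : ℝ) := by
      exact_mod_cast congrArg (Int.cast : ℤ → ℝ) (Int.toNat_of_nonneg h0)
    rw [this, hcos]
  · refine ⟨(24 * m - w).toNat, by omega, by omega, ?_⟩
    have : (((24 * m - w).toNat : ℕ) : ℝ) = 24 * m - (w : ℝ) := by
      have := congrArg (Int.cast : ℤ → ℝ) (Int.toNat_of_nonneg (a := 24 * m - w) (by omega))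
      push_cast at this
      exact_mod_cast this
    rw [this, hcos]
    have : (24 * m - (w : ℝ)) * θ = 2 * π - w * θ := by rw [← hθ]; ring
    rw [this, Real.cos_two_pi_sub]

noncomputable def brassRad (m : ℕ) (θ : ℝ) (n : ℕ) : ℝ :=
  if n = 24 * m then 0 else if n % 2 = 0 then 1 else 1 / (2 * Real.cos θ)

open Real in
lemma brass_values (m : ℕ) (hm : 1 ≤ m) (θ : ℝ) (hθ : 12 * (m : ℝ) * θ = π) (hc : 0 < cos θ)
    (σ : ℤ) : ∃ U : Finset ℝ, U.card ≤ 12 * m - 1 ∧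
      ∀ n : ℕ, brassRad m θ n * cos (((n : ℝ) - σ) * θ) ∈ U := by
  classical
  obtain ⟨r, hr⟩ : ∃ r, r = 1 / (2 * cos θ) := ⟨_, rfl⟩
  have hrc : r * cos θ = 1 / 2 := by rw [hr]; field_simp
  by_cases hσ : σ % 2 = 0
  · refine ⟨(Finset.range (6 * m + 1)).image (fun j : ℕ => cos ((2 * j : ℕ) * θ)) ∪
      (Finset.Ico 1 (6 * m - 1)).image (fun j : ℕ => r * cos ((2 * j + 1 : ℕ) * θ)), ?_, ?_⟩
    · refine (Finset.card_union_le _ _).trans ?_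
      have h1 := Finset.card_image_le (s := Finset.range (6 * m + 1))
        (f := fun j : ℕ => cos ((2 * j : ℕ) * θ))
      have h2 := Finset.card_image_le (s := Finset.Ico 1 (6 * m - 1))
        (f := fun j : ℕ => r * cos ((2 * j + 1 : ℕ) * θ))
      rw [Finset.card_range] at h1
      rw [Nat.card_Ico] at h2
      omega
    · have key : ∀ j : ℕ, j ≤ 6 * m → cos ((2 * j : ℕ) * θ) ∈
          (Finset.range (6 * m + 1)).image (fun j : ℕ => cos ((2 * j : ℕ) * θ)) := fun j hj =>
        Finset.mem_image_of_mem _ (by simp; omega)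
      intro n
      obtain ⟨k, hk, hkp, hke⟩ := brass_reduce m hm θ hθ ((n : ℤ) - σ)
      push_cast at hke
      rw [hke, Finset.mem_union]
      unfold brassRad
      split_ifs with h1 h2
      · left
        have := key (3 * m) (by omega)
        have e : ((2 * (3 * m) : ℕ) : ℝ) * θ = π / 2 := by rw [← hθ]; push_cast; ring
        rw [e, cos_pi_div_two] at this
        simpa using this
      · left
        obtain ⟨j, rfl⟩ : ∃ j, k = 2 * j := ⟨k / 2, by omega⟩
        rw [one_mul]
        exact key j (by omega)
      · obtain ⟨j, rfl⟩ : ∃ j, k = 2 * j + 1 := ⟨k / 2, by omega⟩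
        rw [← hr]
        by_cases hj0 : j = 0
        · left
          have := key (2 * m) (by omega)
          have e : ((2 * (2 * m) : ℕ) : ℝ) * θ = π / 3 := by rw [← hθ]; push_cast; ring
          rw [e, cos_pi_div_three] at this
          rw [hj0]
          simpa [hrc] using this
        by_cases hj1 : j = 6 * m - 1
        · left
          have := key (4 * m) (by omega)
          have e : ((2 * (4 * m) : ℕ) : ℝ) * θ = π - π / 3 := by rw [← hθ]; push_cast; ring
          rw [e, cos_pi_sub, cos_pi_div_three] at this
          have e2 : ((2 * j + 1 : ℕ) : ℝ) * θ = π - θ := by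
            have : 2 * j + 1 + 1 = 12 * m := by omega
            have : ((2 * j + 1 : ℕ) : ℝ) + 1 = 12 * m := by exact_mod_cast this
            rw [← hθ, ← this]; ring
          rw [e2, cos_pi_sub, mul_neg, hrc]
          exact this
        right
        exact Finset.mem_image_of_mem (fun j : ℕ => r * cos ((2 * j + 1 : ℕ) * θ))
          (by simp; omega)
  · refine ⟨(Finset.range (6 * m)).image (fun j : ℕ => cos ((2 * j + 1 : ℕ) * θ)) ∪
      (((Finset.range (6 * m + 1)).erase (3 * m - 1)).erase (3 * m + 1)).image
        (fun j : ℕ => r * cos ((2 * j : ℕ) * θ)), ?_, ?_⟩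
    · refine (Finset.card_union_le _ _).trans ?_
      have h1 := Finset.card_image_le (s := Finset.range (6 * m))
        (f := fun j : ℕ => cos ((2 * j + 1 : ℕ) * θ))
      have h2 := Finset.card_image_le
        (s := ((Finset.range (6 * m + 1)).erase (3 * m - 1)).erase (3 * m + 1))
        (f := fun j : ℕ => r * cos ((2 * j : ℕ) * θ))
      rw [Finset.card_range] at h1
      rw [Finset.card_erase_of_mem (by simp; omega), Finset.card_erase_of_mem (by simp; omega),
        Finset.card_range] at h2
      omega
    · have key : ∀ j : ℕ, j < 6 * m → cos ((2 * j + 1 : ℕ) * θ) ∈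
          (Finset.range (6 * m)).image (fun j : ℕ => cos ((2 * j + 1 : ℕ) * θ)) := fun j hj =>
        Finset.mem_image_of_mem (fun j : ℕ => cos ((2 * j + 1 : ℕ) * θ)) (by simp; omega)
      have key2 : ∀ j : ℕ, j ≤ 6 * m → j ≠ 3 * m - 1 → j ≠ 3 * m + 1 →
          r * cos ((2 * j : ℕ) * θ) ∈
          (((Finset.range (6 * m + 1)).erase (3 * m - 1)).erase (3 * m + 1)).image
            (fun j : ℕ => r * cos ((2 * j : ℕ) * θ)) := fun j hj h1 h2 =>
        Finset.mem_image_of_mem (fun j : ℕ => r * cos ((2 * j : ℕ) * θ)) (by simp; omega)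
      have hs : r * sin (2 * θ) = sin θ := by
        rw [sin_two_mul, hr]; field_simp
      intro n
      obtain ⟨k, hk, hkp, hke⟩ := brass_reduce m hm θ hθ ((n : ℤ) - σ)
      push_cast at hke
      rw [hke, Finset.mem_union]
      unfold brassRad
      split_ifs with h1 h2
      · right
        have := key2 (3 * m) (by omega) (by omega) (by omega)
        have e : ((2 * (3 * m) : ℕ) : ℝ) * θ = π / 2 := by rw [← hθ]; push_cast; ring
        rw [e, cos_pi_div_two, mul_zero] at this
        rw [zero_mul]
        exact this
      · left
        obtain ⟨j, rfl⟩ : ∃ j, k = 2 * j + 1 := ⟨k / 2, by omega⟩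
        rw [one_mul]
        exact key j (by omega)
      · obtain ⟨j, rfl⟩ : ∃ j, k = 2 * j := ⟨k / 2, by omega⟩
        rw [← hr]
        by_cases hj0 : j = 3 * m - 1
        · left
          have := key (3 * m - 1) (by omega)
          have e : ((2 * (3 * m - 1) + 1 : ℕ) : ℝ) * θ = π / 2 - θ := by
            have : 2 * (3 * m - 1) + 1 + 1 = 6 * m := by omega
            have : ((2 * (3 * m - 1) + 1 : ℕ) : ℝ) + 1 = 6 * m := by exact_mod_cast this
            rw [eq_sub_of_add_eq this, ← hθ]; ring
          have e2 : ((2 * j : ℕ) : ℝ) * θ = π / 2 - 2 * θ := by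
            have : 2 * j + 2 = 6 * m := by omega
            have : ((2 * j : ℕ) : ℝ) + 2 = 6 * m := by exact_mod_cast this
            rw [eq_sub_of_add_eq this, ← hθ]; ring
          rw [e, cos_pi_div_two_sub] at this
          rw [e2, cos_pi_div_two_sub, hs]
          exact this
        by_cases hj1 : j = 3 * m + 1
        · left
          have := key (3 * m) (by omega)
          have e : ((2 * (3 * m) + 1 : ℕ) : ℝ) * θ = θ + π / 2 := by
            rw [← hθ]; push_cast; ring
          have e2 : ((2 * j : ℕ) : ℝ) * θ = 2 * θ + π / 2 := by
            rw [hj1, ← hθ]; push_cast; ring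
          rw [e, cos_add_pi_div_two] at this
          rw [e2, cos_add_pi_div_two, mul_neg, hs]
          exact this
        right
        exact key2 j (by omega) hj0 hj1

open Real in
lemma brass_inj (m : ℕ) (hm : 1 ≤ m) (θ : ℝ) (hθ : 12 * (m : ℝ) * θ = π) (hc : 1 / 2 < cos θ)
    (a b : ℕ) (ha : a ≤ 24 * m) (hb : b ≤ 24 * m)
    (h1 : brassRad m θ a * cos (a * θ) = brassRad m θ b * cos (b * θ))
    (h2 : brassRad m θ a * sin (a * θ) = brassRad m θ b * sin (b * θ)) : a = b := by
  have hm' : (1 : ℝ) ≤ m := by exact_mod_cast hm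
  have hr0 : 0 < 1 / (2 * cos θ) := by positivity
  have hr1 : 1 / (2 * cos θ) < 1 := by rw [div_lt_one (by positivity)]; linarith
  have hnn : ∀ n, 0 ≤ brassRad m θ n := by
    intro n; unfold brassRad; split_ifs <;> linarith
  have hsq : brassRad m θ a = brassRad m θ b := by
    have : brassRad m θ a ^ 2 = brassRad m θ b ^ 2 := by
      have e1 := sin_sq_add_cos_sq (a * θ)
      have e2 := sin_sq_add_cos_sq (b * θ)
      calc brassRad m θ a ^ 2 = (brassRad m θ a * sin (a * θ)) ^ 2
            + (brassRad m θ a * cos (a * θ)) ^ 2 := by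
              linear_combination - brassRad m θ a ^ 2 * e1
        _ = _ := by rw [h1, h2]; linear_combination brassRad m θ b ^ 2 * e2
    exact (sq_eq_sq₀ (hnn a) (hnn b)).1 this
  by_cases hA : a = 24 * m
  · by_cases hB : b = 24 * m
    · omega
    · exfalso
      unfold brassRad at hsq
      rw [if_pos hA, if_neg hB] at hsq
      split_ifs at hsq <;> linarith
  by_cases hB : b = 24 * m
  · exfalso
    unfold brassRad at hsq
    rw [if_pos hB, if_neg hA] at hsq
    split_ifs at hsq <;> linarith
  have hb0 : brassRad m θ b ≠ 0 := by
    unfold brassRad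
    rw [if_neg hB]
    split_ifs <;> linarith
  rw [hsq] at h1 h2
  have h1 := mul_left_cancel₀ hb0 h1
  have h2 := mul_left_cancel₀ hb0 h2
  have h3 : cos (a * θ - b * θ) = 1 := by
    rw [cos_sub, h1, h2]
    linear_combination sin_sq_add_cos_sq (b * θ)
  obtain ⟨k, hk⟩ := (cos_eq_one_iff _).1 h3
  have hθ0 : θ ≠ 0 := by
    rintro rfl
    have := pi_pos
    simp at hθ
    linarith
  have h4 : (k : ℝ) * (24 * m) = a - b := by
    apply mul_right_cancel₀ hθ0
    rw [← hθ] at hk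
    linear_combination hk
  have h5 : k * (24 * m) = (a : ℤ) - b := by exact_mod_cast h4
  have hk0 : k = 0 := by
    by_contra hne
    rcases lt_or_gt_of_ne hne with h | h
    · have : k ≤ -1 := by omega
      nlinarith [mul_le_mul_of_nonneg_right this (show (0 : ℤ) ≤ 24 * m by omega), show a < 24 * m by omega, show b < 24 * m by omega]
    · have : 1 ≤ k := by omega
      nlinarith [mul_le_mul_of_nonneg_right this (show (0 : ℤ) ≤ 24 * m by omega), show a < 24 * m by omega, show b < 24 * m by omega]
  rw [hk0] at h5
  omega

lemma brass_mem_vert (t : ℝ) (p : ℝ × ℝ) :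
    p ∈ AffineSubspace.mk' ((t, 0) : ℝ × ℝ) (Submodule.span ℝ {((0, 1) : ℝ × ℝ)}) ↔ p.1 = t := by
  rw [AffineSubspace.mem_mk', Submodule.mem_span_singleton]
  constructor
  · rintro ⟨c, hc⟩
    have := congrArg Prod.fst hc
    simp at this
    linarith
  · intro h
    exact ⟨p.2, by ext <;> simp [h]⟩

lemma brass_mem_trans (a b : ℝ) (p : ℝ × ℝ) :
    p ∈ AffineSubspace.mk' ((0, b) : ℝ × ℝ) (Submodule.span ℝ {((1, a) : ℝ × ℝ)}) ↔
      p.2 = a * p.1 + b := by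
  rw [AffineSubspace.mem_mk', Submodule.mem_span_singleton]
  constructor
  · rintro ⟨c, hc⟩
    have h1 := congrArg Prod.fst hc
    have h2 := congrArg Prod.snd hc
    simp at h1 h2
    rw [← h1]
    linarith
  · intro h
    exact ⟨p.1, by ext <;> simp [h, mul_comm]⟩

lemma brass_isLine (p v : ℝ × ℝ) (hv : v ≠ 0) :
    IsLine (AffineSubspace.mk' p (Submodule.span ℝ {v})) := by
  unfold IsLine
  rw [AffineSubspace.direction_mk']
  exact finrank_span_singleton hv

open Real in
theorem brass_transversals_twelve_m_minus_one (m : ℕ) (hm : 1 ≤ m) (N : ℕ) (hN : N = 12 * m - 1) :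
    ∃ l : Fin N → AffineSubspace ℝ (ℝ × ℝ),
      ∃ lam : Fin (2 * N + 3) → AffineSubspace ℝ (ℝ × ℝ),
        (∀ i, IsLine (l i)) ∧ Function.Injective l ∧
        (∀ i j, (l i).direction = (l j).direction) ∧
        (∀ j, IsLine (lam j)) ∧ Function.Injective lam ∧
        (∀ j i, (lam j).direction ≠ (l i).direction) ∧
        (∀ i, (⋃ j, ((l i : Set (ℝ × ℝ)) ∩ (lam j : Set (ℝ × ℝ)))).ncard ≤ N) := by
  have hm' : (1 : ℝ) ≤ m := by exact_mod_cast hm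
  obtain ⟨θ, hθ⟩ : ∃ θ : ℝ, 12 * (m : ℝ) * θ = π := ⟨π / (12 * m), by field_simp⟩
  have hπ := pi_pos
  have hθ0 : 0 < θ := by
    by_contra h
    nlinarith
  have hc : 1 / 2 < cos θ := by
    rw [← cos_pi_div_three]
    apply cos_lt_cos_of_nonneg_of_le_pi hθ0.le (by linarith)
    nlinarith
  have hang : ∀ i : Fin N, -(π / 2) < (((i : ℤ) - (6 * m - 1) : ℤ) : ℝ) * θ ∧
      (((i : ℤ) - (6 * m - 1) : ℤ) : ℝ) * θ < π / 2 := by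
    intro i
    have hi := i.2
    have h1 : -(6 * (m : ℤ)) < ((i : ℤ) - (6 * m - 1) : ℤ) := by omega
    have h2 : ((i : ℤ) - (6 * m - 1) : ℤ) < 6 * (m : ℤ) := by omega
    have h1 : -(6 * (m : ℝ)) < (((i : ℤ) - (6 * m - 1) : ℤ) : ℝ) := by exact_mod_cast h1
    have h2 : (((i : ℤ) - (6 * m - 1) : ℤ) : ℝ) < 6 * (m : ℝ) := by exact_mod_cast h2
    constructor <;> nlinarith
  refine ⟨fun i => AffineSubspace.mk' (tan ((((i : ℤ) - (6 * m - 1) : ℤ) : ℝ) * θ), 0)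
      (Submodule.span ℝ {((0, 1) : ℝ × ℝ)}),
    fun j => AffineSubspace.mk' (0, brassRad m θ j * cos ((j : ℕ) * θ))
      (Submodule.span ℝ {((1, brassRad m θ j * sin ((j : ℕ) * θ)) : ℝ × ℝ)}),
    ?_, ?_, ?_, ?_, ?_, ?_, ?_⟩
  · intro i
    exact brass_isLine _ _ (by simp)
  · intro i j h
    have h0 := (brass_mem_vert (tan ((((i : ℤ) - (6 * m - 1) : ℤ) : ℝ) * θ))
      (tan ((((i : ℤ) - (6 * m - 1) : ℤ) : ℝ) * θ), 0)).2 rfl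
    simp only at h
    rw [h, brass_mem_vert] at h0
    have h1 := injOn_tan ⟨(hang i).1, (hang i).2⟩ ⟨(hang j).1, (hang j).2⟩ h0
    have h2 := mul_right_cancel₀ hθ0.ne' h1
    have h3 := Int.cast_injective (α := ℝ) h2
    ext
    omega
  · intro i j
    simp only [AffineSubspace.direction_mk']
  · intro i
    exact brass_isLine _ _ (by simp)
  · intro i j h
    simp only at h
    have key : ∀ x : ℝ, (brassRad m θ i * sin ((i : ℕ) * θ)) * x + brassRad m θ i * cos ((i : ℕ) * θ)
        = (brassRad m θ j * sin ((j : ℕ) * θ)) * x + brassRad m θ j * cos ((j : ℕ) * θ) := by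
      intro x
      have h0 := (brass_mem_trans (brassRad m θ i * sin ((i : ℕ) * θ))
        (brassRad m θ i * cos ((i : ℕ) * θ)) (x, (brassRad m θ i * sin ((i : ℕ) * θ)) * x
          + brassRad m θ i * cos ((i : ℕ) * θ))).2 rfl
      rw [h, brass_mem_trans] at h0
      exact h0
    have k0 := key 0
    have k1 := key 1
    ext
    have hi := i.2
    have hj := j.2
    exact brass_inj m hm θ hθ hc i j (by omega) (by omega) (by linarith) (by linarith)
  · intro j i h
    simp only [AffineSubspace.direction_mk'] at h
    have : ((1, brassRad m θ j * sin ((j : ℕ) * θ)) : ℝ × ℝ) ∈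
        Submodule.span ℝ {((0, 1) : ℝ × ℝ)} := by
      rw [← h]; exact Submodule.mem_span_singleton_self _
    obtain ⟨c, hc⟩ := Submodule.mem_span_singleton.1 this
    have := congrArg Prod.fst hc
    simp at this
  · intro i
    obtain ⟨U, hU, hmem⟩ := brass_values m hm θ hθ (by linarith) ((i : ℤ) - (6 * m - 1))
    obtain ⟨φ, hφ⟩ : ∃ φ, φ = (((i : ℤ) - (6 * m - 1) : ℤ) : ℝ) * θ := ⟨_, rfl⟩
    have hcφ : 0 < cos φ := by
      rw [hφ]; exact cos_pos_of_mem_Ioo ⟨(hang i).1, (hang i).2⟩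
    classical
    let V : Finset (ℝ × ℝ) := U.image (fun v => (tan φ, v / cos φ))
    have hV : V.card ≤ N := by
      rw [hN]; exact Finset.card_image_le.trans hU
    refine le_trans (Set.ncard_le_ncard (t := (V : Set (ℝ × ℝ))) ?_ V.finite_toSet) ?_
    · intro p hp
      obtain ⟨j, hp1, hp2⟩ := Set.mem_iUnion.1 hp
      have hp1 := (brass_mem_vert _ _).1 hp1
      have hp2 := (brass_mem_trans _ _ _).1 hp2
      rw [← hφ] at hp1
      refine Finset.mem_coe.2 (Finset.mem_image.2 ⟨_, hmem j, ?_⟩)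
      rw [sub_mul, ← hφ, cos_sub]
      ext
      · exact hp1.symm
      · rw [hp2, hp1, tan_eq_sin_div_cos]
        field_simp
        ring
    · rw [Set.ncard_coe_finset]; exact hV
end

section
/- There exist a set P of 26 points in the real projective plane and 21 distinct projective lines each of which contains exactly 5 points of P. (The configuration consists of three nested pentagrams together with the five points where the line at infinity meets parallel sides of the three stars.) -/
namespace TriplePentagram

/-- The doubled vertices `2 v_k` of an affinely regular pentagon, over `ℤ[√5]`. -/
def vert : Fin 5 → Fin 2 → ℤ√5 :=
  ![![2, 0], ![0, 2], ![-2, ⟨-1, 1⟩], ![⟨1, -1⟩, ⟨1, -1⟩], ![⟨-1, 1⟩, -2]]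

/-- The `k`-th vertex of the `r`-th nested pentagon, in homogeneous coordinates. -/
def star (r : Fin 4) (k : Fin 5) : Fin 3 → ℤ√5 :=
  ![(-1) ^ (r : ℕ) * vert k 0, (-1) ^ (r : ℕ) * vert k 1,
    (![2, ⟨3, 1⟩, ⟨7, 3⟩, ⟨18, 8⟩] : Fin 4 → ℤ√5) r]

/-- Index type of points: vertices, points at infinity, and the centre. -/
abbrev PI := (Fin 4 × Fin 5) ⊕ Fin 5 ⊕ Unit

/-- Index type of lines: star sides, axes, and the line at infinity. -/
abbrev LI := (Fin 3 × Fin 5) ⊕ Fin 5 ⊕ Unit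

/-- Cross product in coordinates. -/
def cr (a b : Fin 3 → ℤ√5) : Fin 3 → ℤ√5 :=
  ![a 1 * b 2 - a 2 * b 1, a 2 * b 0 - a 0 * b 2, a 0 * b 1 - a 1 * b 0]

/-- The points. -/
def pt : PI → Fin 3 → ℤ√5
  | .inl (r, k) => star r k
  | .inr (.inl k) => ![vert (k + 1) 0 - vert (k + 4) 0, vert (k + 1) 1 - vert (k + 4) 1, 0]
  | .inr (.inr _) => ![0, 0, 1]

/-- The lines, as coefficient vectors. -/
def ln : LI → Fin 3 → ℤ√5
  | .inl (r, k) => cr (star r.castSucc (k + 1)) (star r.castSucc (k + 4))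
  | .inr (.inl k) => cr (star 0 k) ![0, 0, 1]
  | .inr (.inr _) => ![0, 0, 1]

/-- Incidence. -/
def inc (l : LI) (p : PI) : Bool :=
  decide (ln l 0 * pt p 0 + ln l 1 * pt p 1 + ln l 2 * pt p 2 = 0)

theorem pt_sep : ∀ p q : PI, p ≠ q → ∃ l, inc l p ∧ ¬ inc l q := by decide +kernel

theorem ln_sep : ∀ l m : LI, l ≠ m → ∃ p, inc l p ∧ ¬ inc m p := by decide +kernel

theorem five : ∀ l : LI, (Finset.univ.filter fun p => inc l p = true).card = 5 := by
  decide +kernel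

theorem pt_ne : ∀ p, ∃ i, pt p i ≠ 0 := by decide +kernel

theorem ln_ne : ∀ l, ∃ i, ln l i ≠ 0 := by decide +kernel

/-- The embedding of `ℤ[√5]` in `ℝ`. -/
noncomputable def emb : ℤ√5 →+* ℝ := Zsqrtd.toReal (by norm_num)

theorem emb_inj : Function.Injective emb := by
  apply Zsqrtd.toReal_injective
  intro n h
  have h1 : n ≤ 3 := by nlinarith
  have h2 : -3 ≤ n := by nlinarith
  interval_cases n <;> omega

/-- Real coordinates of a point. -/
noncomputable def rp (p : PI) : Fin 3 → ℝ := fun i => emb (pt p i)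

theorem rp_ne (p : PI) : rp p ≠ 0 := by
  obtain ⟨i, hi⟩ := pt_ne p
  intro h
  exact hi (emb_inj (by simpa [rp] using congrFun h i))

/-- The projective points. -/
noncomputable def pp (p : PI) : Projectivization ℝ (Fin 3 → ℝ) :=
  Projectivization.mk ℝ (rp p) (rp_ne p)

/-- The linear form of a line. -/
noncomputable def form (l : LI) : (Fin 3 → ℝ) →ₗ[ℝ] ℝ :=
  Fintype.linearCombination ℝ (fun i => emb (ln l i))

theorem form_ne (l : LI) : form l ≠ 0 := by
  obtain ⟨i, hi⟩ := ln_ne l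
  intro h
  apply hi
  apply emb_inj
  have := LinearMap.congr_fun h (Pi.single i 1)
  simpa [form, Fintype.linearCombination_apply_single] using this

/-- The line as a plane in `ℝ³`. -/
noncomputable def pl (l : LI) : Submodule ℝ (Fin 3 → ℝ) := LinearMap.ker (form l)

theorem pp_le (l : LI) (p : PI) : (pp p).submodule ≤ pl l ↔ inc l p = true := by
  rw [pp, Projectivization.submodule_mk, Submodule.span_singleton_le_iff_mem, pl,
    LinearMap.mem_ker]
  have : form l (rp p) = emb (ln l 0 * pt p 0 + ln l 1 * pt p 1 + ln l 2 * pt p 2) := by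
    simp [form, Fintype.linearCombination_apply, Fin.sum_univ_three, rp]
    ring
  rw [this, inc, decide_eq_true_iff, map_eq_zero_iff _ emb_inj]

theorem pp_inj : Function.Injective pp := by
  intro p q h
  by_contra hne
  obtain ⟨l, h1, h2⟩ := pt_sep p q hne
  rw [← pp_le] at h1 h2
  exact h2 (h ▸ h1)

theorem pl_inj : Function.Injective pl := by
  intro l m h
  by_contra hne
  obtain ⟨p, h1, h2⟩ := ln_sep l m hne
  rw [← pp_le] at h1 h2
  exact h2 (h ▸ h1)

end TriplePentagram

open TriplePentagram in
/-- There exist a set `P` of 26 points in the real projective plane (the projectivization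
of ℝ³) and 21 distinct projective lines (projectivizations of 2-dimensional subspaces of
ℝ³) each of which contains exactly 5 points of `P`. -/
theorem triple_pentagram_projective :
    ∃ P : Finset (Projectivization ℝ (Fin 3 → ℝ)), P.card = 26 ∧
      ∃ L : Finset (Submodule ℝ (Fin 3 → ℝ)), L.card = 21 ∧
        ∀ W ∈ L, Module.finrank ℝ W = 2 ∧
          ({x : Projectivization ℝ (Fin 3 → ℝ) | x.submodule ≤ W} ∩ ↑P).ncard = 5 := by
  refine ⟨Finset.univ.map ⟨pp, pp_inj⟩, ?_, Finset.univ.map ⟨pl, pl_inj⟩, ?_, ?_⟩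
  · simp
  · simp
  · intro W hW
    obtain ⟨l, -, rfl⟩ := Finset.mem_map.1 hW
    refine ⟨?_, ?_⟩
    · have := Module.Dual.finrank_ker_add_one_of_ne_zero (form_ne l)
      rw [Module.finrank_fin_fun] at this
      change Module.finrank ℝ (LinearMap.ker (form l)) = 2
      omega
    · have : ({x : Projectivization ℝ (Fin 3 → ℝ) | x.submodule ≤ pl l} ∩
          ↑(Finset.univ.map ⟨pp, pp_inj⟩)) =
          Set.image pp ↑(Finset.univ.filter fun p => inc l p = true) := by
        ext x
        simp only [Set.mem_inter_iff, Set.mem_ofPred_eq, Finset.coe_map, Finset.coe_univ,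
          Set.image_univ, Set.mem_range, Function.Embedding.coeFn_mk, Set.mem_image,
          Finset.coe_filter, Finset.mem_univ, true_and]
        constructor
        · rintro ⟨h, p, rfl⟩
          exact ⟨p, (pp_le l p).1 h, rfl⟩
        · rintro ⟨p, h, rfl⟩
          exact ⟨(pp_le l p).2 h, p, rfl⟩
      change ({x : Projectivization ℝ (Fin 3 → ℝ) | x.submodule ≤ pl l} ∩
          ↑(Finset.univ.map ⟨pp, pp_inj⟩)).ncard = 5
      rw [this, Set.ncard_image_of_injective _ pp_inj, Set.ncard_coe_finset, five]
end

section
/- There exists a set S of 21 points in ℝ² such that there are at least 12 distinct lines each containing exactly 5 points of S. (Such a configuration is projectively equivalent to the 16 points (i,j) with 1 ≤ i,j ≤ 4, the points (3/2, 5/2) and (5/2, 3/2), and the three points at infinity contained in the four lines x=i, the four lines y=j, and the three lines x=y, x−y=±1; the twelfth line is x+y=4.) -/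
/-- The 21 points (an integral affine image of the projective configuration). -/
def intPts : Finset (ℤ × ℤ) :=
  {(84, 84), (140, 280), (420, 1260), (-420, -1680),
   (280, 140), (840, 840), (-840, -1260), (-280, -560),
   (1260, 420), (-1260, -840), (-420, -420), (-252, -336),
   (-1680, -420), (-560, -280), (-336, -252), (-240, -240),
   (630, 1050), (1050, 630), (-210, 0), (0, -210),
   (-105, -105)}

/-- The 12 lines, each given by two of its points. -/
def intLines : Finset ((ℤ × ℤ) × (ℤ × ℤ)) :=
  {((84, 84), (140, 280)), ((280, 140), (840, 840)),
   ((1260, 420), (-1260, -840)), ((-1680, -420), (-560, -280)),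
   ((84, 84), (280, 140)), ((140, 280), (840, 840)),
   ((420, 1260), (-840, -1260)), ((-420, -1680), (-280, -560)),
   ((84, 84), (840, 840)), ((140, 280), (-840, -1260)),
   ((280, 140), (-1260, -840)), ((630, 1050), (1050, 630))}

/-- Integral incidence: `x` is on the line through `t.1` and `t.2`. -/
abbrev Inc (t : (ℤ × ℤ) × (ℤ × ℤ)) (x : ℤ × ℤ) : Prop :=
  (t.2.1 - t.1.1) * (x.2 - t.1.2) = (t.2.2 - t.1.2) * (x.1 - t.1.1)

/-- Cast of an integral point to the real plane. -/
def castPt (x : ℤ × ℤ) : ℝ × ℝ := ((x.1 : ℝ), (x.2 : ℝ))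

lemma castPt_injective : Function.Injective castPt := by
  rintro ⟨a, b⟩ ⟨c, d⟩ h
  simpa [castPt] using h

/-- The real line through two integral points. -/
noncomputable def lineOf (t : (ℤ × ℤ) × (ℤ × ℤ)) : AffineSubspace ℝ (ℝ × ℝ) :=
  AffineSubspace.mk' (castPt t.1) (Submodule.span ℝ {castPt t.2 - castPt t.1})

lemma isLine_lineOf (t : (ℤ × ℤ) × (ℤ × ℤ)) (h : t.1 ≠ t.2) : IsLine (lineOf t) := by
  unfold IsLine lineOf
  rw [AffineSubspace.direction_mk']
  exact finrank_span_singleton (sub_ne_zero.2 fun e => h (castPt_injective e.symm))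

lemma mem_span_iff_cross (v w : ℝ × ℝ) (hv : v ≠ 0) :
    w ∈ Submodule.span ℝ {v} ↔ v.1 * w.2 = v.2 * w.1 := by
  rw [Submodule.mem_span_singleton]
  obtain ⟨a, b⟩ := v
  obtain ⟨c, d⟩ := w
  constructor
  · rintro ⟨r, hr⟩
    simp only [Prod.smul_mk, smul_eq_mul, Prod.mk.injEq] at hr
    obtain ⟨rfl, rfl⟩ := hr
    simp only
    ring
  · intro h
    simp only at h
    by_cases ha : a = 0
    · subst ha
      have hb : b ≠ 0 := by
        rintro rfl
        exact hv rfl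
      have hc : c = 0 := by
        rcases mul_eq_zero.1 (h.symm.trans (zero_mul d)) with h1 | h1
        · exact absurd h1 hb
        · exact h1
      refine ⟨d / b, ?_⟩
      simp [hc, hb]
    · refine ⟨c / a, ?_⟩
      simp only [Prod.smul_mk, smul_eq_mul, Prod.mk.injEq]
      constructor
      · field_simp
      · field_simp
        linarith

lemma mem_lineOf (t : (ℤ × ℤ) × (ℤ × ℤ)) (h : t.1 ≠ t.2) (x : ℤ × ℤ) :
    castPt x ∈ lineOf t ↔ Inc t x := by
  unfold lineOf
  rw [AffineSubspace.mem_mk', vsub_eq_sub,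
    mem_span_iff_cross _ _ (sub_ne_zero.2 fun e => h (castPt_injective e.symm))]
  simp only [castPt, Prod.fst_sub, Prod.snd_sub, Inc]
  norm_cast

lemma intLines_ne : ∀ t ∈ intLines, t.1 ≠ t.2 := by decide +kernel

lemma intLines_five : ∀ t ∈ intLines, (intPts.filter (Inc t)).card = 5 := by decide +kernel

lemma intLines_distinct : ∀ t ∈ intLines, ∀ s ∈ intLines,
    (∀ x ∈ intPts, Inc t x ↔ Inc s x) → t = s := by decide +kernel

/-- There exists a set `S` of 21 points in ℝ² such that there are at least 12 distinct
lines each containing exactly 5 points of `S`. -/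
theorem twentyone_points_twelve_lines_of_five :
    ∃ S : Finset (ℝ × ℝ), S.card = 21 ∧
      ∃ L : Finset (AffineSubspace ℝ (ℝ × ℝ)), 12 ≤ L.card ∧
        ∀ l ∈ L, IsLine l ∧ ((l : Set (ℝ × ℝ)) ∩ ↑S).ncard = 5 := by
  classical
  refine ⟨intPts.image castPt, ?_, intLines.image lineOf, ?_, ?_⟩
  · rw [Finset.card_image_of_injective _ castPt_injective]
    decide +kernel
  · rw [Finset.card_image_of_injOn]
    · decide +kernel
    · intro t ht s hs hts
      refine intLines_distinct t ht s hs fun x _ => ?_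
      rw [← mem_lineOf t (intLines_ne t ht), ← mem_lineOf s (intLines_ne s hs), hts]
  · intro l hl
    obtain ⟨t, ht, rfl⟩ := Finset.mem_image.1 hl
    have hne := intLines_ne t ht
    refine ⟨isLine_lineOf t hne, ?_⟩
    have key : ((lineOf t : Set (ℝ × ℝ)) ∩ ↑(intPts.image castPt))
        = ↑((intPts.filter (Inc t)).image castPt) := by
      ext y
      simp only [Set.mem_inter_iff, SetLike.mem_coe, Finset.coe_image, Set.mem_image,
        Finset.mem_filter]
      constructor
      · rintro ⟨h1, x, hx, rfl⟩
        exact ⟨x, ⟨hx, (mem_lineOf t hne x).1 h1⟩, rfl⟩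
      · rintro ⟨x, ⟨hx, h1⟩, rfl⟩
        exact ⟨(mem_lineOf t hne x).2 h1, x, hx, rfl⟩
    rw [key, Set.ncard_coe_finset, Finset.card_image_of_injective _ castPt_injective]
    exact intLines_five t ht
end

section
/- Let x, y ∈ ℤ³ be nonzero vectors all of whose coordinates lie in {−1, 0, 1}. If the dot product x·y = x₁y₁ + x₂y₂ + x₃y₃ is nonzero and divisible by 3, then x = y or x = −y, and every coordinate of x equals 1 or −1. (Equivalently: the only incidences between the 13 octahedral points and 13 octahedral lines that appear upon reduction modulo 3 but not over ℝ are those with (x₁ : x₂ : x₃) = (y₁ : y₂ : y₃) = (±1 : ±1 : ±1).) -/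
/-- Products of two elements of `{-1, 0, 1}`. -/
theorem coord_mul_aux (a b : ℤ) (ha : a = -1 ∨ a = 0 ∨ a = 1) (hb : b = -1 ∨ b = 0 ∨ b = 1) :
    -1 ≤ a * b ∧ a * b ≤ 1 ∧ (a * b = 1 → a = b ∧ (a = 1 ∨ a = -1)) ∧
      (a * b = -1 → a = -b ∧ (a = 1 ∨ a = -1)) := by
  rcases ha with rfl | rfl | rfl <;> rcases hb with rfl | rfl | rfl <;> norm_num

/-- Let `x, y ∈ ℤ³` be nonzero vectors with all coordinates in `{-1, 0, 1}`. If the dot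
product `x·y` is nonzero and divisible by 3, then `x = y` or `x = -y`, and every
coordinate of `x` equals `1` or `-1`. -/
theorem octahedral_incidences_mod_three (x y : Fin 3 → ℤ) (hx : x ≠ 0) (hy : y ≠ 0)
    (hx1 : ∀ i, x i = -1 ∨ x i = 0 ∨ x i = 1)
    (hy1 : ∀ i, y i = -1 ∨ y i = 0 ∨ y i = 1)
    (hne : (∑ i, x i * y i) ≠ 0) (hdvd : (3 : ℤ) ∣ ∑ i, x i * y i) :
    (x = y ∨ x = -y) ∧ (∀ i, x i = 1 ∨ x i = -1) := by
  have key := fun i => coord_mul_aux (x i) (y i) (hx1 i) (hy1 i)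
  rw [Fin.sum_univ_three] at hne hdvd
  obtain ⟨l0, u0, -⟩ := key 0
  obtain ⟨l1, u1, -⟩ := key 1
  obtain ⟨l2, u2, -⟩ := key 2
  have hcases : (∀ i, x i * y i = 1) ∨ (∀ i, x i * y i = -1) := by
    simp only [Fin.forall_fin_succ, Fin.forall_fin_zero_pi, Fin.succ_zero_eq_one,
      Fin.succ_one_eq_two, IsEmpty.forall_iff, and_true]
    omega
  rcases hcases with h | h
  · exact ⟨Or.inl (funext fun i => ((key i).2.2.1 (h i)).1), fun i => ((key i).2.2.1 (h i)).2⟩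
  · exact ⟨Or.inr (funext fun i => ((key i).2.2.2 (h i)).1), fun i => ((key i).2.2.2 (h i)).2⟩
end

section
/- There exist a set P of 16 points in the real projective plane, a set L of 15 projective lines each containing exactly 4 points of P, and a subgroup G of the group of projective linear transformations PGL₃(ℝ) isomorphic to the alternating group A₅, such that the action of G on the real projective plane maps P to P and maps (the set of) lines L to L, the induced action of G on L is transitive, and the induced action of G on P has exactly two orbits, of sizes 6 and 10. -/
/-- The projective general linear group PGL₃(ℝ): the quotient of the group of invertible
3×3 real matrices by its center (the nonzero scalar matrices). -/
abbrev PGL3 : Type :=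
  GL (Fin 3) ℝ ⧸ Subgroup.center (GL (Fin 3) ℝ)

/-- The action of an invertible 3×3 real matrix on the real projective plane (the
projectivization of ℝ³).  Since scalar matrices act trivially, this also describes the
action of the corresponding element of PGL₃(ℝ). -/
noncomputable def projAct (g : GL (Fin 3) ℝ) (p : Projectivization ℝ (Fin 3 → ℝ)) :
    Projectivization ℝ (Fin 3 → ℝ) :=
  Projectivization.map
    (LinearMap.GeneralLinearGroup.toLinearEquiv (Matrix.GeneralLinearGroup.toLin g)).toLinearMap
    (LinearMap.GeneralLinearGroup.toLinearEquiv (Matrix.GeneralLinearGroup.toLin g)).injective p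

/-- The corresponding action of an invertible 3×3 real matrix on projective lines,
viewed as 2-dimensional linear subspaces of ℝ³. -/
noncomputable def lineAct (g : GL (Fin 3) ℝ) (W : Submodule ℝ (Fin 3 → ℝ)) :
    Submodule ℝ (Fin 3 → ℝ) :=
  W.map (LinearMap.GeneralLinearGroup.toLinearEquiv (Matrix.GeneralLinearGroup.toLin g)).toLinearMap

section IcosahedralAux

open Equiv

/-- The ring of integers ℤ[φ] of ℚ(√5), with computable arithmetic (`⟨a, b⟩` is `a + b φ`). -/
abbrev ZPhi : Type := QuadraticAlgebra ℤ 1 1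

/-- The vertex of the icosahedron attached to a 5-cycle `c` (in one of the two conjugacy classes
of 5-cycles of A₅), as a function of `c 0` and `c (c 0)`. -/
def vertexTable : Fin 5 → Fin 5 → Fin 3 → ZPhi := ![
  ![![0, 0, 0],
    ![0, 0, 0],
    ![0, 0, 0],
    ![0, 0, 0],
    ![0, 0, 0]],
  ![![0, 0, 0],
    ![0, 0, 0],
    ![⟨0, 0⟩, ⟨1, 0⟩, ⟨0, 0⟩],
    ![⟨-1, 0⟩, ⟨1, -1⟩, ⟨-1, 1⟩],
    ![⟨-1, 1⟩, ⟨1, -1⟩, ⟨-1, 0⟩]],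
  ![![0, 0, 0],
    ![⟨-1, 0⟩, ⟨0, 0⟩, ⟨0, 0⟩],
    ![0, 0, 0],
    ![⟨0, 0⟩, ⟨0, 0⟩, ⟨1, 0⟩],
    ![⟨1, 0⟩, ⟨-1, 1⟩, ⟨1, -1⟩]],
  ![![0, 0, 0],
    ![⟨1, -1⟩, ⟨-1, 0⟩, ⟨1, -1⟩],
    ![⟨1, -1⟩, ⟨-1, 1⟩, ⟨1, 0⟩],
    ![0, 0, 0],
    ![⟨1, 0⟩, ⟨0, 0⟩, ⟨0, 0⟩]],
  ![![0, 0, 0],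
    ![⟨0, 0⟩, ⟨0, 0⟩, ⟨-1, 0⟩],
    ![⟨-1, 1⟩, ⟨1, 0⟩, ⟨-1, 1⟩],
    ![⟨0, 0⟩, ⟨-1, 0⟩, ⟨0, 0⟩],
    ![0, 0, 0]]]

/-- Three 5-cycles, whose vertices are the standard basis. -/
def baseCycle : Fin 3 → Fin 5 → Fin 5 := ![![3, 2, 0, 4, 1], ![1, 2, 3, 4, 0], ![2, 4, 3, 1, 0]]

/-- The icosahedral representation: the `k`-th column of `rho g` is the vertex of `g c_k g⁻¹`. -/
def rho (g : Perm (Fin 5)) : Matrix (Fin 3) (Fin 3) ZPhi := fun i k =>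
  vertexTable (g (baseCycle k (g.symm 0))) (g (baseCycle k (baseCycle k (g.symm 0)))) i

/-- The six 5-fold axes. -/
def axes6 : Fin 6 → Fin 3 → ZPhi := ![
  ![⟨1, 0⟩, ⟨0, 0⟩, ⟨0, 0⟩],
  ![⟨0, 0⟩, ⟨1, 0⟩, ⟨0, 0⟩],
  ![⟨0, 0⟩, ⟨0, 0⟩, ⟨1, 0⟩],
  ![⟨-1, 1⟩, ⟨1, -1⟩, ⟨-1, 0⟩],
  ![⟨-1, 1⟩, ⟨1, 0⟩, ⟨-1, 1⟩],
  ![⟨-1, 0⟩, ⟨1, -1⟩, ⟨-1, 1⟩]]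

/-- The ten 3-fold axes. -/
def axes10 : Fin 10 → Fin 3 → ZPhi := ![
  ![⟨0, -1⟩, ⟨-1, 0⟩, ⟨0, -1⟩],
  ![⟨-1, -1⟩, ⟨0, -1⟩, ⟨0, 0⟩],
  ![⟨0, 1⟩, ⟨0, 0⟩, ⟨-1, -1⟩],
  ![⟨-1, -1⟩, ⟨0, 0⟩, ⟨0, 1⟩],
  ![⟨-1, 0⟩, ⟨1, 0⟩, ⟨-1, 0⟩],
  ![⟨0, -1⟩, ⟨-1, -1⟩, ⟨0, 0⟩],
  ![⟨1, 0⟩, ⟨0, 1⟩, ⟨0, -1⟩],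
  ![⟨0, 0⟩, ⟨0, -1⟩, ⟨-1, -1⟩],
  ![⟨0, -1⟩, ⟨0, 1⟩, ⟨1, 0⟩],
  ![⟨0, 0⟩, ⟨-1, -1⟩, ⟨0, -1⟩]]

/-- The normal covectors of the fifteen mirror planes. -/
def normals : Fin 15 → Fin 3 → ZPhi := ![
  ![⟨0, 0⟩, ⟨0, 0⟩, ⟨-1, -2⟩],
  ![⟨0, 0⟩, ⟨-1, -2⟩, ⟨0, 0⟩],
  ![⟨1, 2⟩, ⟨0, 0⟩, ⟨0, 0⟩],
  ![⟨-1, -2⟩, ⟨0, 0⟩, ⟨-1, -1⟩],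
  ![⟨0, 0⟩, ⟨1, 2⟩, ⟨-1, -1⟩],
  ![⟨-1, -1⟩, ⟨0, 0⟩, ⟨-1, -2⟩],
  ![⟨0, 0⟩, ⟨-1, -1⟩, ⟨-1, -1⟩],
  ![⟨1, 1⟩, ⟨0, 0⟩, ⟨-1, -1⟩],
  ![⟨0, 0⟩, ⟨1, 1⟩, ⟨-1, -2⟩],
  ![⟨1, 1⟩, ⟨-1, -2⟩, ⟨0, 0⟩],
  ![⟨-1, -1⟩, ⟨1, 2⟩, ⟨-1, -2⟩],
  ![⟨1, 2⟩, ⟨-1, -1⟩, ⟨0, 0⟩],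
  ![⟨-1, -2⟩, ⟨1, 1⟩, ⟨-1, -2⟩],
  ![⟨1, 2⟩, ⟨-1, -2⟩, ⟨1, 1⟩],
  ![⟨-1, -1⟩, ⟨-1, -1⟩, ⟨0, 0⟩]]

open Matrix

/-- The 5-cycle `i ↦ i + 1` of `A₅`. -/
def genS : Perm (Fin 5) := finRotate 5

/-- The 3-cycle `0 ↦ 1 ↦ 2 ↦ 0` of `A₅`. -/
def genT : Perm (Fin 5) := swap 0 1 * swap 1 2

lemma exists_word : ∀ g : Perm (Fin 5), Perm.sign g = 1 →
    ∃ (i : Fin 5) (a : Fin 3) (b : Fin 2) (c : Fin 3),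
      g = genS ^ (i : ℕ) * (genT ^ (a : ℕ) * ((genS * genT * genS ^ 4) ^ (b : ℕ) *
        genT ^ (c : ℕ))) := by
  decide +kernel

lemma sign_genS : Perm.sign genS = 1 := by decide +kernel
lemma sign_genT : Perm.sign genT = 1 := by decide +kernel

/-- Induction principle for `A₅`: left multiplication by the two generators. -/
lemma alt_induction {p : Perm (Fin 5) → Prop} (h1 : p 1)
    (hS : ∀ g, Perm.sign g = 1 → p g → p (genS * g))
    (hT : ∀ g, Perm.sign g = 1 → p g → p (genT * g))
    (g : Perm (Fin 5)) (hg : Perm.sign g = 1) : p g := by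
  have key : ∀ x ∈ Submonoid.closure ({genS, genT} : Set (Perm (Fin 5))),
      Perm.sign x = 1 ∧ p x := by
    intro x hx
    induction hx using Submonoid.closure_induction_left with
    | one => exact ⟨by simp, h1⟩
    | mul_left x hx y hy ih =>
      rcases hx with rfl | hx
      · exact ⟨by rw [map_mul, ih.1, sign_genS]; rfl, hS _ ih.1 ih.2⟩
      · rw [Set.mem_singleton_iff.mp hx]
        exact ⟨by rw [map_mul, ih.1, sign_genT]; rfl, hT _ ih.1 ih.2⟩
  have mS : genS ∈ Submonoid.closure ({genS, genT} : Set (Perm (Fin 5))) :=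
    Submonoid.subset_closure (by simp)
  have mT : genT ∈ Submonoid.closure ({genS, genT} : Set (Perm (Fin 5))) :=
    Submonoid.subset_closure (by simp)
  obtain ⟨i, a, b, c, rfl⟩ := exists_word g hg
  exact (key _ (mul_mem (pow_mem mS _) (mul_mem (pow_mem mT _)
    (mul_mem (pow_mem (mul_mem (mul_mem mS mT) (pow_mem mS _)) _) (pow_mem mT _))))).2

lemma rho_one : rho 1 = 1 := by decide +kernel

lemma rho_genS_mul : ∀ h : Perm (Fin 5), Perm.sign h = 1 →
    rho (genS * h) = rho genS * rho h := by decide +kernel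

lemma rho_genT_mul : ∀ h : Perm (Fin 5), Perm.sign h = 1 →
    rho (genT * h) = rho genT * rho h := by decide +kernel

lemma rho_mul (g h : Perm (Fin 5)) (hg : Perm.sign g = 1) (hh : Perm.sign h = 1) :
    rho (g * h) = rho g * rho h := by
  refine alt_induction (p := fun g => rho (g * h) = rho g * rho h) ?_ ?_ ?_ g hg
  · simp only [rho_one, one_mul]
  · intro g hg ih
    rw [mul_assoc, rho_genS_mul _ (by rw [map_mul, hg, hh]; rfl), ih, rho_genS_mul _ hg, mul_assoc]
  · intro g hg ih
    rw [mul_assoc, rho_genT_mul _ (by rw [map_mul, hg, hh]; rfl), ih, rho_genT_mul _ hg, mul_assoc]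

lemma rho_scalar : ∀ g : Perm (Fin 5), Perm.sign g = 1 →
    (rho g 0 1 = 0 ∧ rho g 0 2 = 0 ∧ rho g 1 0 = 0 ∧ rho g 1 2 = 0) → g = 1 := by decide +kernel

/-- Equality up to sign. -/
def PM (x y : Fin 3 → ZPhi) : Prop := x = y ∨ x = -y

instance (x y : Fin 3 → ZPhi) : Decidable (PM x y) := inferInstanceAs (Decidable (_ ∨ _))

lemma PM.symm {x y : Fin 3 → ZPhi} (h : PM x y) : PM y x := by
  rcases h with rfl | rfl
  · exact Or.inl rfl
  · exact Or.inr (by simp)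

lemma PM.trans {x y z : Fin 3 → ZPhi} (h : PM x y) (h' : PM y z) : PM x z := by
  rcases h with rfl | rfl <;> rcases h' with rfl | rfl <;> simp [PM]

lemma PM.mulVec {x y : Fin 3 → ZPhi} (h : PM x y) (M : Matrix (Fin 3) (Fin 3) ZPhi) :
    PM (M *ᵥ x) (M *ᵥ y) := by
  rcases h with rfl | rfl
  · exact Or.inl rfl
  · exact Or.inr (by rw [mulVec_neg])

lemma PM.vecMul {x y : Fin 3 → ZPhi} (h : PM x y) (M : Matrix (Fin 3) (Fin 3) ZPhi) :
    PM (x ᵥ* M) (y ᵥ* M) := by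
  rcases h with rfl | rfl
  · exact Or.inl rfl
  · exact Or.inr (by rw [neg_vecMul])

lemma mulVec_orbit {ι : Type*} (V : ι → Fin 3 → ZPhi)
    (hS : ∀ i, ∃ j, PM (rho genS *ᵥ V i) (V j)) (hT : ∀ i, ∃ j, PM (rho genT *ᵥ V i) (V j))
    (g : Perm (Fin 5)) (hg : Perm.sign g = 1) : ∀ i, ∃ j, PM (rho g *ᵥ V i) (V j) := by
  refine alt_induction (p := fun g => ∀ i, ∃ j, PM (rho g *ᵥ V i) (V j)) ?_ ?_ ?_ g hg
  · exact fun i => ⟨i, Or.inl (by rw [rho_one, one_mulVec])⟩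
  · intro g hg ih i
    obtain ⟨j, hj⟩ := ih i
    obtain ⟨k, hk⟩ := hS j
    refine ⟨k, ?_⟩
    rw [rho_genS_mul _ hg, ← mulVec_mulVec]
    exact (hj.mulVec _).trans hk
  · intro g hg ih i
    obtain ⟨j, hj⟩ := ih i
    obtain ⟨k, hk⟩ := hT j
    refine ⟨k, ?_⟩
    rw [rho_genT_mul _ hg, ← mulVec_mulVec]
    exact (hj.mulVec _).trans hk

lemma rho_inv_mul (g : Perm (Fin 5)) (hg : Perm.sign g = 1) : rho g⁻¹ * rho g = 1 := by
  rw [← rho_mul _ _ (by rw [Perm.sign_inv, hg]) hg, inv_mul_cancel, rho_one]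

lemma rho_mul_inv (g : Perm (Fin 5)) (hg : Perm.sign g = 1) : rho g * rho g⁻¹ = 1 := by
  rw [← rho_mul _ _ hg (by rw [Perm.sign_inv, hg]), mul_inv_cancel, rho_one]

lemma mulVec_trans {ι : Type*} (V : ι → Fin 3 → ZPhi) (i₀ : ι)
    (h : ∀ j, ∃ g : Perm (Fin 5), Perm.sign g = 1 ∧ PM (rho g *ᵥ V i₀) (V j)) (i j : ι) :
    ∃ g : Perm (Fin 5), Perm.sign g = 1 ∧ PM (rho g *ᵥ V i) (V j) := by
  obtain ⟨a, ha, hai⟩ := h i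
  obtain ⟨b, hb, hbj⟩ := h j
  have ha' : Perm.sign a⁻¹ = 1 := by rw [Perm.sign_inv, ha]
  refine ⟨b * a⁻¹, by rw [map_mul, hb, ha']; rfl, ?_⟩
  have := hai.symm.mulVec (rho a⁻¹)
  rw [mulVec_mulVec, rho_inv_mul a ha, one_mulVec] at this
  rw [rho_mul _ _ hb ha', ← mulVec_mulVec]
  exact (this.mulVec _).trans hbj

lemma vecMul_orbit {ι : Type*} (N : ι → Fin 3 → ZPhi)
    (hS : ∀ i, ∃ j, PM (N j ᵥ* rho genS) (N i)) (hT : ∀ i, ∃ j, PM (N j ᵥ* rho genT) (N i))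
    (g : Perm (Fin 5)) (hg : Perm.sign g = 1) : ∀ i, ∃ j, PM (N j ᵥ* rho g) (N i) := by
  refine alt_induction (p := fun g => ∀ i, ∃ j, PM (N j ᵥ* rho g) (N i)) ?_ ?_ ?_ g hg
  · exact fun i => ⟨i, Or.inl (by rw [rho_one, vecMul_one])⟩
  · intro g hg ih i
    obtain ⟨j, hj⟩ := ih i
    obtain ⟨k, hk⟩ := hS j
    refine ⟨k, ?_⟩
    rw [rho_genS_mul _ hg, ← vecMul_vecMul]
    exact (hk.vecMul _).trans hj
  · intro g hg ih i
    obtain ⟨j, hj⟩ := ih i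
    obtain ⟨k, hk⟩ := hT j
    refine ⟨k, ?_⟩
    rw [rho_genT_mul _ hg, ← vecMul_vecMul]
    exact (hk.vecMul _).trans hj

lemma vecMul_trans {ι : Type*} (N : ι → Fin 3 → ZPhi) (i₀ : ι)
    (h : ∀ j, ∃ g : Perm (Fin 5), Perm.sign g = 1 ∧ PM (N j ᵥ* rho g) (N i₀)) (i j : ι) :
    ∃ g : Perm (Fin 5), Perm.sign g = 1 ∧ PM (N j ᵥ* rho g) (N i) := by
  obtain ⟨a, ha, hai⟩ := h i
  obtain ⟨b, hb, hbj⟩ := h j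
  have ha' : Perm.sign a⁻¹ = 1 := by rw [Perm.sign_inv, ha]
  refine ⟨b * a⁻¹, by rw [map_mul, hb, ha']; rfl, ?_⟩
  have := hai.symm.vecMul (rho a⁻¹)
  rw [vecMul_vecMul, rho_mul_inv a ha, vecMul_one] at this
  rw [rho_mul _ _ hb ha', ← vecMul_vecMul]
  exact (hbj.vecMul _).trans this

lemma axes6_orbit : ∀ g : Perm (Fin 5), Perm.sign g = 1 →
    ∀ i, ∃ j, PM (rho g *ᵥ axes6 i) (axes6 j) :=
  mulVec_orbit axes6 (by decide +kernel) (by decide +kernel)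

lemma axes10_orbit : ∀ g : Perm (Fin 5), Perm.sign g = 1 →
    ∀ i, ∃ j, PM (rho g *ᵥ axes10 i) (axes10 j) :=
  mulVec_orbit axes10 (by decide +kernel) (by decide +kernel)

lemma normals_orbit : ∀ g : Perm (Fin 5), Perm.sign g = 1 →
    ∀ i, ∃ j, PM (normals j ᵥ* rho g) (normals i) :=
  vecMul_orbit normals (by decide +kernel) (by decide +kernel)

lemma axes6_trans : ∀ i j, ∃ g : Perm (Fin 5), Perm.sign g = 1 ∧
    PM (rho g *ᵥ axes6 i) (axes6 j) :=
  mulVec_trans axes6 0 (by decide +kernel)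

lemma axes10_trans : ∀ i j, ∃ g : Perm (Fin 5), Perm.sign g = 1 ∧
    PM (rho g *ᵥ axes10 i) (axes10 j) :=
  mulVec_trans axes10 0 (by decide +kernel)

lemma normals_trans : ∀ i j, ∃ g : Perm (Fin 5), Perm.sign g = 1 ∧
    PM (normals j ᵥ* rho g) (normals i) :=
  vecMul_trans normals 0 (by decide +kernel)

/-- All sixteen axes. -/
def axes : Fin 6 ⊕ Fin 10 → Fin 3 → ZPhi := Sum.elim axes6 axes10

lemma incidence (k : Fin 15) :
    (Finset.univ.filter fun i : Fin 6 ⊕ Fin 10 => normals k ⬝ᵥ axes i = 0).card = 4 := by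
  revert k; decide +kernel

lemma axes_distinct : ∀ i j : Fin 6 ⊕ Fin 10, i ≠ j →
    ∃ a b, axes i a * axes j b ≠ axes i b * axes j a := by decide +kernel

lemma normals_distinct : ∀ k l, k ≠ l →
    ∃ i, normals k ⬝ᵥ axes i = 0 ∧ normals l ⬝ᵥ axes i ≠ 0 := by decide +kernel

lemma axes_ne : ∀ i, axes i ≠ 0 := by decide +kernel

lemma normals_ne : ∀ i, normals i ≠ 0 := by decide +kernel

/-- The embedding of `ℤ[φ]` in `ℝ`. -/
noncomputable def toReal : ZPhi →+* ℝ :=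
  (QuadraticAlgebra.lift (R := ℤ) (a := 1) (b := 1) (A := ℝ)
    ⟨Real.goldenRatio, by
      have := Real.goldenRatio_sq
      rw [← pow_two, this]; simp [add_comm]⟩).toRingHom

lemma toReal_apply (z : ZPhi) : toReal z = z.re + z.im * Real.goldenRatio := by
  simp [toReal]

lemma toReal_injective : Function.Injective toReal := by
  rw [injective_iff_map_eq_zero]
  intro z hz
  rw [toReal_apply] at hz
  have him : z.im = 0 := by
    by_contra h
    have h' : (z.im : ℝ) ≠ 0 := by exact_mod_cast h
    apply Real.goldenRatio_irrational
    refine ⟨-z.re / z.im, ?_⟩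
    push_cast
    rw [div_eq_iff h']
    linarith
  rw [him] at hz
  have hre : z.re = 0 := by simpa using hz
  ext <;> simp [him, hre]

/-- The embedding on vectors. -/
noncomputable def realVec (v : Fin 3 → ZPhi) : Fin 3 → ℝ := toReal ∘ v

lemma vec_ne {v : Fin 3 → ZPhi} (hv : v ≠ 0) : realVec v ≠ 0 := by
  intro h
  apply hv
  ext1 i
  apply toReal_injective
  simpa [realVec] using congrFun h i

lemma realVec_neg (v : Fin 3 → ZPhi) : realVec (-v) = -realVec v := by
  ext i; simp [realVec]

lemma vec_mulVec (M : Matrix (Fin 3) (Fin 3) ZPhi) (v : Fin 3 → ZPhi) :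
    M.map toReal *ᵥ realVec v = realVec (M *ᵥ v) := by
  ext i
  exact (RingHom.map_mulVec toReal M v i).symm

lemma vec_vecMul (M : Matrix (Fin 3) (Fin 3) ZPhi) (v : Fin 3 → ZPhi) :
    realVec v ᵥ* M.map toReal = realVec (v ᵥ* M) := by
  ext i
  exact (RingHom.map_vecMul toReal M v i).symm

lemma vec_dot (v w : Fin 3 → ZPhi) : realVec v ⬝ᵥ realVec w = toReal (v ⬝ᵥ w) :=
  (RingHom.map_dotProduct toReal v w).symm

lemma vec_dot_eq_zero (v w : Fin 3 → ZPhi) : realVec v ⬝ᵥ realVec w = 0 ↔ v ⬝ᵥ w = 0 := by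
  rw [vec_dot, map_eq_zero_iff _ toReal_injective]

/-- The icosahedral representation as a homomorphism to `GL₃(ℝ)`. -/
noncomputable def repGL : alternatingGroup (Fin 5) →* GL (Fin 3) ℝ :=
  MonoidHom.toHomUnits
    { toFun := fun g => (rho g).map toReal
      map_one' := by
        rw [OneMemClass.coe_one, rho_one]
        exact Matrix.map_one _ (map_zero _) (map_one _)
      map_mul' := fun g h => by
        rw [Subgroup.coe_mul, rho_mul _ _ (Perm.mem_alternatingGroup.mp g.2)
          (Perm.mem_alternatingGroup.mp h.2), Matrix.map_mul] }

lemma repGL_val (g : alternatingGroup (Fin 5)) :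
    (repGL g : Matrix (Fin 3) (Fin 3) ℝ) = (rho g).map toReal := rfl

/-- The icosahedral representation in `PGL₃(ℝ)`. -/
noncomputable def repPGL : alternatingGroup (Fin 5) →* PGL3 :=
  (QuotientGroup.mk' (Subgroup.center (GL (Fin 3) ℝ))).comp repGL

lemma repPGL_injective : Function.Injective repPGL := by
  rw [injective_iff_map_eq_one]
  intro g hg
  have h1 : repGL g ∈ Subgroup.center (GL (Fin 3) ℝ) := (QuotientGroup.eq_one_iff _).mp hg
  obtain ⟨c, hc⟩ := Matrix.GeneralLinearGroup.mem_center_iff_val_mem_range_scalar.mp h1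
  rw [repGL_val] at hc
  have off : ∀ i j, i ≠ j → rho g i j = 0 := by
    intro i j hij
    apply toReal_injective
    have := congrFun (congrFun hc i) j
    rw [map_zero]
    simpa [Matrix.scalar_apply, hij] using this.symm
  apply Subtype.ext
  exact rho_scalar g (Perm.mem_alternatingGroup.mp g.2)
    ⟨off _ _ (by decide), off _ _ (by decide), off _ _ (by decide), off _ _ (by decide)⟩

lemma exists_of_mem_range {g : GL (Fin 3) ℝ} (hg : (QuotientGroup.mk g : PGL3) ∈ repPGL.range) :
    ∃ σ : Perm (Fin 5), Perm.sign σ = 1 ∧ ∃ c : ℝ, c ≠ 0 ∧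
      (g : Matrix (Fin 3) (Fin 3) ℝ) = c • (rho σ).map toReal := by
  obtain ⟨σ, hσ⟩ := hg
  have h1 : (repGL σ)⁻¹ * g ∈ Subgroup.center (GL (Fin 3) ℝ) := QuotientGroup.eq.mp hσ
  obtain ⟨c, hc⟩ := Matrix.GeneralLinearGroup.mem_center_iff_val_mem_range_scalar.mp h1
  have h2 : (g : Matrix (Fin 3) (Fin 3) ℝ) = c • (rho σ).map toReal := by
    have h3 : g = repGL σ * ((repGL σ)⁻¹ * g) := by group
    rw [h3, Units.val_mul, ← hc, repGL_val]
    ext i j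
    simp [Matrix.scalar_apply, mul_comm]
  refine ⟨σ, Perm.mem_alternatingGroup.mp σ.2, c, ?_, h2⟩
  rintro rfl
  rw [zero_smul] at h2
  exact g.ne_zero h2

lemma exists_GL (σ : Perm (Fin 5)) (hσ : Perm.sign σ = 1) :
    ∃ g : GL (Fin 3) ℝ, (QuotientGroup.mk g : PGL3) ∈ repPGL.range ∧
      (g : Matrix (Fin 3) (Fin 3) ℝ) = (1 : ℝ) • (rho σ).map toReal :=
  ⟨repGL ⟨σ, Perm.mem_alternatingGroup.mpr hσ⟩, ⟨_, rfl⟩, by rw [one_smul]; rfl⟩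

lemma toLin_apply (g : GL (Fin 3) ℝ) (v : Fin 3 → ℝ) :
    (LinearMap.GeneralLinearGroup.toLinearEquiv (Matrix.GeneralLinearGroup.toLin g)).toLinearMap v
      = (g : Matrix (Fin 3) (Fin 3) ℝ) *ᵥ v := by
  rfl

/-- The projective point of a nonzero vector over `ℤ[φ]`. -/
noncomputable def pt (i : Fin 6 ⊕ Fin 10) : Projectivization ℝ (Fin 3 → ℝ) :=
  Projectivization.mk ℝ (realVec (axes i)) (vec_ne (axes_ne i))

lemma pt_injective : Function.Injective pt := by
  intro i j h
  by_contra hij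
  obtain ⟨a, b, hab⟩ := axes_distinct i j hij
  obtain ⟨c, hc⟩ := (Projectivization.mk_eq_mk_iff' ℝ _ _ _ _).mp h
  apply hab
  apply toReal_injective
  have ha : c * toReal (axes j a) = toReal (axes i a) := congrFun hc a
  have hb : c * toReal (axes j b) = toReal (axes i b) := congrFun hc b
  rw [map_mul, map_mul, ← ha, ← hb]
  ring

lemma projAct_pt {g : GL (Fin 3) ℝ} {σ : Perm (Fin 5)} {c : ℝ} (hc : c ≠ 0)
    (hg : (g : Matrix (Fin 3) (Fin 3) ℝ) = c • (rho σ).map toReal) {i j : Fin 6 ⊕ Fin 10}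
    (h : PM (rho σ *ᵥ axes i) (axes j)) : projAct g (pt i) = pt j := by
  unfold projAct pt
  rw [Projectivization.map_mk, Projectivization.mk_eq_mk_iff']
  rw [toLin_apply, hg, smul_mulVec, vec_mulVec]
  rcases h with h | h
  · exact ⟨c, by rw [h]⟩
  · exact ⟨-c, by rw [h, realVec_neg, smul_neg, neg_smul]⟩

/-- The projective lines, as planes in `ℝ³`. -/
noncomputable def line (k : Fin 15) : Submodule ℝ (Fin 3 → ℝ) :=
  LinearMap.ker (dotProductBilin ℝ ℝ (realVec (normals k)))

lemma mem_line (k : Fin 15) (x : Fin 3 → ℝ) : x ∈ line k ↔ realVec (normals k) ⬝ᵥ x = 0 := by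
  simp [line]

lemma finrank_line (k : Fin 15) : Module.finrank ℝ (line k) = 2 := by
  have hne : dotProductBilin ℝ ℝ (realVec (normals k)) ≠ 0 := by
    intro h
    apply vec_ne (normals_ne k)
    apply dotProduct_self_eq_zero.mp
    simpa using LinearMap.congr_fun h (realVec (normals k))
  have := Module.Dual.finrank_ker_add_one_of_ne_zero (V₁ := Fin 3 → ℝ) hne
  rw [Module.finrank_fin_fun] at this
  have h2 : Module.finrank ℝ (line k) + 1 = 3 := this
  omega

lemma pt_le_line (i : Fin 6 ⊕ Fin 10) (k : Fin 15) :
    (pt i).submodule ≤ line k ↔ normals k ⬝ᵥ axes i = 0 := by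
  rw [pt, Projectivization.submodule_mk, Submodule.span_singleton_le_iff_mem, mem_line,
    vec_dot_eq_zero]

lemma line_injective : Function.Injective line := by
  intro k l h
  by_contra hkl
  obtain ⟨i, h1, h2⟩ := normals_distinct k l hkl
  apply h2
  rw [← pt_le_line, ← h, pt_le_line]
  exact h1

lemma lineAct_line {g : GL (Fin 3) ℝ} {σ : Perm (Fin 5)} {c : ℝ}
    (hg : (g : Matrix (Fin 3) (Fin 3) ℝ) = c • (rho σ).map toReal) {k l : Fin 15}
    (h : PM (normals l ᵥ* rho σ) (normals k)) : lineAct g (line k) = line l := by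
  apply Submodule.eq_of_le_of_finrank_eq
  · rintro _ ⟨x, hx, rfl⟩
    have hx' : realVec (normals k) ⬝ᵥ x = 0 := (mem_line _ _).mp hx
    rw [mem_line, toLin_apply, hg, smul_mulVec, dotProduct_smul, dotProduct_mulVec, vec_vecMul]
    rcases h with h | h
    · rw [h, hx', smul_zero]
    · rw [h, realVec_neg, neg_dotProduct, hx', neg_zero, smul_zero]
  · rw [finrank_line, ← finrank_line k]
    exact LinearEquiv.finrank_map_eq
      (LinearMap.GeneralLinearGroup.toLinearEquiv (Matrix.GeneralLinearGroup.toLin g)) (line k)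

end IcosahedralAux

/-- There exist a set `P` of 16 points of the real projective plane, a set `L` of 15
projective lines each containing exactly 4 points of `P`, and a subgroup `G` of PGL₃(ℝ)
isomorphic to the alternating group `A₅`, such that `G` maps `P` to `P` and `L` to `L`,
acts transitively on `L`, and acts on `P` with exactly two orbits, of sizes 6 and 10. -/
theorem icosahedral_sixteen_points_fifteen_lines :
    ∃ G : Subgroup PGL3, Nonempty (G ≃* alternatingGroup (Fin 5)) ∧
      ∃ P : Finset (Projectivization ℝ (Fin 3 → ℝ)), P.card = 16 ∧
        ∃ L : Finset (Submodule ℝ (Fin 3 → ℝ)), L.card = 15 ∧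
          (∀ W ∈ L, Module.finrank ℝ W = 2 ∧
            ({x : Projectivization ℝ (Fin 3 → ℝ) | x.submodule ≤ W} ∩ ↑P).ncard = 4) ∧
          -- G maps P to P and L to L:
          (∀ g : GL (Fin 3) ℝ, (QuotientGroup.mk g : PGL3) ∈ G →
            (∀ p ∈ P, projAct g p ∈ P) ∧ (∀ W ∈ L, lineAct g W ∈ L)) ∧
          -- the induced action of G on L is transitive:
          (∀ W₁ ∈ L, ∀ W₂ ∈ L, ∃ g : GL (Fin 3) ℝ,
            (QuotientGroup.mk g : PGL3) ∈ G ∧ lineAct g W₁ = W₂) ∧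
          -- the induced action of G on P has exactly two orbits, of sizes 6 and 10:
          ∃ P₆ P₁₀ : Finset (Projectivization ℝ (Fin 3 → ℝ)),
            (↑P₆ ∪ ↑P₁₀ : Set (Projectivization ℝ (Fin 3 → ℝ))) = ↑P ∧ Disjoint P₆ P₁₀ ∧ P₆.card = 6 ∧ P₁₀.card = 10 ∧
            (∀ g : GL (Fin 3) ℝ, (QuotientGroup.mk g : PGL3) ∈ G →
              (∀ p ∈ P₆, projAct g p ∈ P₆) ∧ (∀ p ∈ P₁₀, projAct g p ∈ P₁₀)) ∧
            (∀ p ∈ P₆, ∀ q ∈ P₆, ∃ g : GL (Fin 3) ℝ,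
              (QuotientGroup.mk g : PGL3) ∈ G ∧ projAct g p = q) ∧
            (∀ p ∈ P₁₀, ∀ q ∈ P₁₀, ∃ g : GL (Fin 3) ℝ,
              (QuotientGroup.mk g : PGL3) ∈ G ∧ projAct g p = q) := by
  classical
  have hP6 : ∀ g : GL (Fin 3) ℝ, (QuotientGroup.mk g : PGL3) ∈ repPGL.range →
      ∀ i, ∃ j, projAct g (pt (Sum.inl i)) = pt (Sum.inl j) := by
    intro g hg i
    obtain ⟨σ, hσ, c, hc, h⟩ := exists_of_mem_range hg
    obtain ⟨j, hj⟩ := axes6_orbit σ hσ i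
    exact ⟨j, projAct_pt hc h hj⟩
  have hP10 : ∀ g : GL (Fin 3) ℝ, (QuotientGroup.mk g : PGL3) ∈ repPGL.range →
      ∀ i, ∃ j, projAct g (pt (Sum.inr i)) = pt (Sum.inr j) := by
    intro g hg i
    obtain ⟨σ, hσ, c, hc, h⟩ := exists_of_mem_range hg
    obtain ⟨j, hj⟩ := axes10_orbit σ hσ i
    exact ⟨j, projAct_pt hc h hj⟩
  refine ⟨repPGL.range, ⟨(MonoidHom.ofInjective repPGL_injective).symm⟩,
    Finset.univ.image pt, ?_, Finset.univ.image line, ?_, ?_, ?_, ?_,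
    Finset.univ.image (pt ∘ Sum.inl), Finset.univ.image (pt ∘ Sum.inr), ?_, ?_, ?_, ?_, ?_, ?_, ?_⟩
  · rw [Finset.card_image_of_injective _ pt_injective]; rfl
  · rw [Finset.card_image_of_injective _ line_injective]; rfl
  · intro W hW
    obtain ⟨k, -, rfl⟩ := Finset.mem_image.mp hW
    refine ⟨finrank_line k, ?_⟩
    have : {x : Projectivization ℝ (Fin 3 → ℝ) | x.submodule ≤ line k} ∩
        ↑(Finset.univ.image pt) =
        ↑((Finset.univ.filter fun i => dotProduct (normals k) (axes i) = 0).image pt) := by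
      ext x
      simp only [Set.mem_inter_iff, Set.mem_ofPred_eq, Finset.mem_coe, Finset.mem_image,
        Finset.mem_univ, true_and, Finset.mem_filter]
      constructor
      · rintro ⟨h, i, rfl⟩
        exact ⟨i, (pt_le_line i k).mp h, rfl⟩
      · rintro ⟨i, h, rfl⟩
        exact ⟨(pt_le_line i k).mpr h, i, rfl⟩
    rw [this, Set.ncard_coe_finset, Finset.card_image_of_injective _ pt_injective]
    convert incidence k
  · intro g hg
    constructor
    · intro p hp
      obtain ⟨i | i, -, rfl⟩ := Finset.mem_image.mp hp
      · obtain ⟨j, hj⟩ := hP6 g hg i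
        rw [hj]; exact Finset.mem_image_of_mem _ (Finset.mem_univ _)
      · obtain ⟨j, hj⟩ := hP10 g hg i
        rw [hj]; exact Finset.mem_image_of_mem _ (Finset.mem_univ _)
    · intro W hW
      obtain ⟨k, -, rfl⟩ := Finset.mem_image.mp hW
      obtain ⟨σ, hσ, c, hc, h⟩ := exists_of_mem_range hg
      obtain ⟨l, hl⟩ := normals_orbit σ hσ k
      rw [lineAct_line h hl]
      exact Finset.mem_image_of_mem _ (Finset.mem_univ _)
  · intro W₁ h₁ W₂ h₂
    obtain ⟨k, -, rfl⟩ := Finset.mem_image.mp h₁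
    obtain ⟨l, -, rfl⟩ := Finset.mem_image.mp h₂
    obtain ⟨σ, hσ, h⟩ := normals_trans k l
    obtain ⟨g, hg, hgm⟩ := exists_GL σ hσ
    exact ⟨g, hg, lineAct_line hgm h⟩
  · ext x
    simp
  · rw [Finset.disjoint_left]
    intro x hx hx'
    obtain ⟨i, -, rfl⟩ := Finset.mem_image.mp hx
    obtain ⟨j, -, h⟩ := Finset.mem_image.mp hx'
    exact Sum.inr_ne_inl (pt_injective h)
  · rw [Finset.card_image_of_injective _ (pt_injective.comp Sum.inl_injective)]; rfl
  · rw [Finset.card_image_of_injective _ (pt_injective.comp Sum.inr_injective)]; rfl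
  · intro g hg
    constructor
    · intro p hp
      obtain ⟨i, -, rfl⟩ := Finset.mem_image.mp hp
      obtain ⟨j, hj⟩ := hP6 g hg i
      exact Finset.mem_image.mpr ⟨j, Finset.mem_univ _, hj.symm⟩
    · intro p hp
      obtain ⟨i, -, rfl⟩ := Finset.mem_image.mp hp
      obtain ⟨j, hj⟩ := hP10 g hg i
      exact Finset.mem_image.mpr ⟨j, Finset.mem_univ _, hj.symm⟩
  · intro p hp q hq
    obtain ⟨i, -, rfl⟩ := Finset.mem_image.mp hp
    obtain ⟨j, -, rfl⟩ := Finset.mem_image.mp hq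
    obtain ⟨σ, hσ, h⟩ := axes6_trans i j
    obtain ⟨g, hg, hgm⟩ := exists_GL σ hσ
    exact ⟨g, hg, projAct_pt one_ne_zero hgm h⟩
  · intro p hp q hq
    obtain ⟨i, -, rfl⟩ := Finset.mem_image.mp hp
    obtain ⟨j, -, rfl⟩ := Finset.mem_image.mp hq
    obtain ⟨σ, hσ, h⟩ := axes10_trans i j
    obtain ⟨g, hg, hgm⟩ := exists_GL σ hσ
    exact ⟨g, hg, projAct_pt one_ne_zero hgm h⟩
end
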